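/- arXiv:0909.0982 — 15 statements merged into one kernel-verified Lean document; each statement's English description precedes it below -/
import Mathlib

section
/- Let X be a zero-dimensional Hausdorff topological space, let Y be a zero-dimensional locally compact Hausdorff space, and let f : X → Y be a topological embedding with dense image. Set A = {f⁻¹(G) : G is a clopen subset of Y} and I = {f⁻¹(G) : G is a compact clopen subset of Y}. Then: (1) A is a Boolean subalgebra of the Boolean algebra CO(X) of clopen subsets of X (i.e. A contains ∅ and X and is closed under finite unions, finite intersections, and complements in X); (2) I is an ideal of A (downward closed in A and closed under finite unions) which is an open base of the topology of X; and (3) the map G ↦ f⁻¹(G) is a Boolean algebra isomorphism from CO(Y) onto A which maps the set CK(Y) of compact clopen subsets of Y onto I. -/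
open Topology TopologicalSpace Set

/-- Clopen subsets are compared by their preimages under a map with dense range. -/
theorem DenseRange.subset_of_preimage_subset {X Y : Type*} [TopologicalSpace Y] {f : X → Y}
    (hd : DenseRange f) {G H : Set Y} (hG : IsOpen G) (hH : IsClosed H)
    (h : f ⁻¹' G ⊆ f ⁻¹' H) : G ⊆ H := by
  by_contra hn
  obtain ⟨y, hyG, hyH⟩ := Set.not_subset.mp hn
  obtain ⟨x, hxG, hxH⟩ := hd.exists_mem_open (hG.sdiff hH) ⟨y, hyG, hyH⟩
  exact hxH (h hxG)

/-- A locally compact space with a base of clopen sets has a base of compact clopen sets. -/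
theorem isTopologicalBasis_isClopen_isCompact {Y : Type*} [TopologicalSpace Y]
    [LocallyCompactSpace Y] (hY : IsTopologicalBasis {s : Set Y | IsClopen s}) :
    IsTopologicalBasis {s : Set Y | IsClopen s ∧ IsCompact s} := by
  refine isTopologicalBasis_of_isOpen_of_nhds (fun s hs => hs.1.isOpen) fun y V hy hV => ?_
  obtain ⟨K, hK, hKV, hKc⟩ := local_compact_nhds (hV.mem_nhds hy)
  obtain ⟨G, hG, hyG, hGK⟩ := hY.mem_nhds_iff.mp hK
  exact ⟨G, ⟨hG, hKc.of_isClosed_subset hG.isClosed hGK⟩, hyG, hGK.trans hKV⟩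

theorem stmt0 {X Y : Type*} [TopologicalSpace X] [T2Space X]
    (hX : IsTopologicalBasis {s : Set X | IsClopen s})
    [TopologicalSpace Y] [T2Space Y] [LocallyCompactSpace Y]
    (hY : IsTopologicalBasis {s : Set Y | IsClopen s})
    (f : X → Y) (hf : IsEmbedding f) (hd : DenseRange f)
    (A I : Set (Set X))
    (hA : A = {S : Set X | ∃ G : Set Y, IsClopen G ∧ S = f ⁻¹' G})
    (hI : I = {S : Set X | ∃ G : Set Y, IsClopen G ∧ IsCompact G ∧ S = f ⁻¹' G}) :
    -- (1) A is a Boolean subalgebra of CO(X)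
    ((∀ S ∈ A, IsClopen S) ∧ (∅ : Set X) ∈ A ∧ (Set.univ : Set X) ∈ A ∧
      (∀ S ∈ A, ∀ T ∈ A, S ∪ T ∈ A) ∧ (∀ S ∈ A, ∀ T ∈ A, S ∩ T ∈ A) ∧
      (∀ S ∈ A, Sᶜ ∈ A)) ∧
    -- (2) I is an ideal of A which is an open base of X
    (I ⊆ A ∧ (∀ S ∈ I, ∀ T ∈ A, T ⊆ S → T ∈ I) ∧
      (∀ S ∈ I, ∀ T ∈ I, S ∪ T ∈ I) ∧ IsTopologicalBasis I) ∧
    -- (3) G ↦ f⁻¹(G) is a Boolean isomorphism from CO(Y) onto A mapping CK(Y) onto I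
    (Set.InjOn (fun G : Set Y => f ⁻¹' G) {G : Set Y | IsClopen G} ∧
      (fun G : Set Y => f ⁻¹' G) '' {G : Set Y | IsClopen G} = A ∧
      (fun G : Set Y => f ⁻¹' G) '' {G : Set Y | IsClopen G ∧ IsCompact G} = I ∧
      (∀ G H : Set Y, f ⁻¹' (G ∪ H) = f ⁻¹' G ∪ f ⁻¹' H) ∧
      (∀ G H : Set Y, f ⁻¹' (G ∩ H) = f ⁻¹' G ∩ f ⁻¹' H) ∧
      (∀ G : Set Y, f ⁻¹' Gᶜ = (f ⁻¹' G)ᶜ)) := by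
  have hIimage : (fun G : Set Y => f ⁻¹' G) '' {G : Set Y | IsClopen G ∧ IsCompact G} = I := by
    subst hI
    ext S
    simp only [mem_image, mem_ofPred_eq, and_assoc, eq_comm]
  have hAimage : (fun G : Set Y => f ⁻¹' G) '' {G : Set Y | IsClopen G} = A := by
    subst hA
    ext S
    simp only [mem_image, mem_ofPred_eq, eq_comm]
  refine ⟨?_, ⟨?_, ?_, ?_, ?_⟩, ?_, hAimage, hIimage, fun _ _ => rfl, fun _ _ => rfl,
    fun _ => rfl⟩
  · subst hA
    refine ⟨?_, ⟨∅, isClopen_empty, rfl⟩, ⟨univ, isClopen_univ, rfl⟩, ?_, ?_, ?_⟩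
    · rintro _ ⟨G, hG, rfl⟩
      exact hG.preimage hf.continuous
    · rintro _ ⟨G, hG, rfl⟩ _ ⟨H, hH, rfl⟩
      exact ⟨G ∪ H, hG.union hH, rfl⟩
    · rintro _ ⟨G, hG, rfl⟩ _ ⟨H, hH, rfl⟩
      exact ⟨G ∩ H, hG.inter hH, rfl⟩
    · rintro _ ⟨G, hG, rfl⟩
      exact ⟨Gᶜ, hG.compl, rfl⟩
  · subst hA hI
    rintro _ ⟨G, hG, -, rfl⟩
    exact ⟨G, hG, rfl⟩
  · subst hA hI
    rintro _ ⟨G, hG, hGc, rfl⟩ _ ⟨H, hH, rfl⟩ h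
    exact ⟨H, hH, hGc.of_isClosed_subset hH.isClosed
      (hd.subset_of_preimage_subset hH.isOpen hG.isClosed h), rfl⟩
  · subst hI
    rintro _ ⟨G, hG, hGc, rfl⟩ _ ⟨H, hH, hHc, rfl⟩
    exact ⟨G ∪ H, hG.union hH, hGc.union hHc, rfl⟩
  · rw [← hIimage]
    exact (isTopologicalBasis_isClopen_isCompact hY).isInducing hf.isInducing
  · intro G hG H hH h
    exact (hd.subset_of_preimage_subset hG.isOpen hH.isClosed h.subset).antisymm
      (hd.subset_of_preimage_subset hH.isOpen hG.isClosed h.symm.subset)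
end

section
/- Let X be a zero-dimensional Hausdorff topological space, let A be a Boolean subalgebra of the Boolean algebra CO(X) of clopen subsets of X, and let I be an ideal of A (downward closed in A and closed under finite unions, containing ∅) which is an open base of the topology of X. Assume further the following ZLB condition: for every subset J ⊆ I that is an ideal of I (downward closed in I, closed under finite unions, containing ∅) for which there exists another ideal J' of I with J ∩ J' = {∅} and such that every element of I is the union of an element of J and an element of J', the family J has a least upper bound with respect to inclusion inside A. Then there exist a zero-dimensional locally compact Hausdorff space Y and a topological embedding f : X → Y with dense image such that A = {f⁻¹(G) : G clopen in Y} and I = {f⁻¹(G) : G compact clopen in Y}. -/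
open Topology TopologicalSpace Set

universe u

open MeasureTheory (IsSetAlgebra)

/-- An ultrafilter of the set algebra `A` that contains a member of the ideal `I`. -/
@[ext]
structure IdealUltrafilter {X : Type u} (A I : Set (Set X)) where
  carrier : Set (Set X)
  subset_algebra : carrier ⊆ A
  empty_notMem : ∅ ∉ carrier
  inter_mem : ∀ S ∈ carrier, ∀ T ∈ carrier, S ∩ T ∈ carrier
  mem_of_superset : ∀ S ∈ carrier, ∀ T ∈ A, S ⊆ T → T ∈ carrier
  mem_or_compl_mem : ∀ S ∈ A, S ∈ carrier ∨ Sᶜ ∈ carrier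
  exists_mem_ideal : ∃ S ∈ I, S ∈ carrier

namespace IdealUltrafilter

variable {X : Type u} {A I : Set (Set X)}

/-- The set of ultrafilters containing `S`. -/
def cyl (A I : Set (Set X)) (S : Set X) : Set (IdealUltrafilter A I) := {p | S ∈ p.carrier}

instance : TopologicalSpace (IdealUltrafilter A I) := generateFrom (cyl A I '' A)

theorem cyl_empty : cyl A I ∅ = ∅ := eq_empty_of_forall_notMem fun p hp => p.empty_notMem hp

theorem cyl_mono {S T : Set X} (hT : T ∈ A) (h : S ⊆ T) : cyl A I S ⊆ cyl A I T :=
  fun p hp => p.mem_of_superset S hp T hT h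

theorem cyl_compl {S : Set X} (hS : S ∈ A) : cyl A I Sᶜ = (cyl A I S)ᶜ := by
  ext p
  refine ⟨fun h h' => p.empty_notMem ?_, fun h => (p.mem_or_compl_mem S hS).resolve_left h⟩
  simpa using p.inter_mem S h' Sᶜ h

theorem cyl_inter {S T : Set X} (hS : S ∈ A) (hT : T ∈ A) :
    cyl A I (S ∩ T) = cyl A I S ∩ cyl A I T := by
  ext p
  exact ⟨fun h => ⟨p.mem_of_superset _ h S hS inter_subset_left,
    p.mem_of_superset _ h T hT inter_subset_right⟩, fun h => p.inter_mem S h.1 T h.2⟩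

theorem cyl_union (hA : IsSetAlgebra A) {S T : Set X} (hS : S ∈ A) (hT : T ∈ A) :
    cyl A I (S ∪ T) = cyl A I S ∪ cyl A I T := by
  rw [← compl_compl (S ∪ T), compl_union,
    cyl_compl (hA.inter_mem (hA.compl_mem hS) (hA.compl_mem hT)),
    cyl_inter (hA.compl_mem hS) (hA.compl_mem hT), cyl_compl hS, cyl_compl hT, compl_inter,
    compl_compl, compl_compl]

theorem isOpen_cyl {S : Set X} (hS : S ∈ A) : IsOpen (cyl A I S) :=
  isOpen_generateFrom_of_mem (mem_image_of_mem _ hS)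

theorem isClopen_cyl (hA : IsSetAlgebra A) {S : Set X} (hS : S ∈ A) : IsClopen (cyl A I S) :=
  ⟨⟨cyl_compl (I := I) hS ▸ isOpen_cyl (hA.compl_mem hS)⟩, isOpen_cyl hS⟩

theorem isTopologicalBasis_cyl (hA : IsSetAlgebra A) (hIA : I ⊆ A)
    (hIdown : ∀ S ∈ I, ∀ T ∈ A, T ⊆ S → T ∈ I) :
    IsTopologicalBasis (cyl A I '' I) := by
  have hbasis : IsTopologicalBasis (cyl A I '' A) := by
    refine ⟨?_, ?_, rfl⟩
    · rintro _ ⟨S, hS, rfl⟩ _ ⟨T, hT, rfl⟩ p hp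
      rw [← cyl_inter hS hT] at hp ⊢
      exact ⟨_, mem_image_of_mem _ (hA.inter_mem hS hT), hp, Subset.rfl⟩
    · refine eq_univ_of_forall fun p => ?_
      obtain ⟨S, hS, hp⟩ := p.exists_mem_ideal
      exact ⟨_, mem_image_of_mem _ (hIA hS), hp⟩
  refine isTopologicalBasis_of_isOpen_of_nhds ?_ fun p U hp hU => ?_
  · rintro _ ⟨S, hS, rfl⟩
    exact isOpen_cyl (hIA hS)
  · obtain ⟨_, ⟨T, hT, rfl⟩, hpT, hTU⟩ := hbasis.exists_subset_of_mem_open hp hU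
    obtain ⟨S, hS, hpS⟩ := p.exists_mem_ideal
    have hST := hA.inter_mem (hIA hS) hT
    exact ⟨_, mem_image_of_mem _ (hIdown S hS _ hST inter_subset_left), p.inter_mem S hpS T hpT,
      (cyl_mono hT inter_subset_right).trans hTU⟩

theorem isCompact_cyl (hA : IsSetAlgebra A) (hIA : I ⊆ A) {S : Set X} (hS : S ∈ I) :
    IsCompact (cyl A I S) := by
  refine isCompact_iff_ultrafilter_le_nhds'.2 fun F hF => ?_
  let p : IdealUltrafilter A I :=
    { carrier := {T | T ∈ A ∧ cyl A I T ∈ F}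
      subset_algebra := fun T hT => hT.1
      empty_notMem := fun h => F.empty_notMem (cyl_empty (A := A) (I := I) ▸ h.2)
      inter_mem := fun T hT T' hT' => ⟨hA.inter_mem hT.1 hT'.1,
        cyl_inter (I := I) hT.1 hT'.1 ▸ Filter.inter_mem hT.2 hT'.2⟩
      mem_of_superset := fun T hT T' hT' h =>
        ⟨hT', Filter.mem_of_superset hT.2 (cyl_mono hT' h)⟩
      mem_or_compl_mem := fun T hT => (F.mem_or_compl_mem (cyl A I T)).imp (fun h => ⟨hT, h⟩)
        fun h => ⟨hA.compl_mem hT, (cyl_compl (I := I) hT).symm ▸ h⟩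
      exists_mem_ideal := ⟨S, hS, hIA hS, hF⟩ }
  refine ⟨p, ⟨hIA hS, hF⟩, ?_⟩
  rw [nhds_generateFrom]
  refine le_iInf₂ fun U hU => Filter.le_principal_iff.2 ?_
  obtain ⟨hpU, T, hT, rfl⟩ := hU
  exact hpU.2

theorem t2Space (hA : IsSetAlgebra A) : T2Space (IdealUltrafilter A I) := by
  have key : ∀ p q : IdealUltrafilter A I, (∀ S ∈ p.carrier, S ∈ q.carrier) → p = q := by
    refine fun p q h => IdealUltrafilter.ext (Subset.antisymm h fun S hS => ?_)
    have hSA := q.subset_algebra hS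
    refine (p.mem_or_compl_mem S hSA).resolve_right fun hc => ?_
    have hq : q ∈ cyl A I Sᶜ := h _ hc
    rw [cyl_compl hSA] at hq
    exact hq hS
  refine ⟨fun p q hpq => ?_⟩
  obtain ⟨S, hp, hq⟩ : ∃ S ∈ p.carrier, S ∉ q.carrier := by
    by_contra! h
    exact hpq (key p q h)
  have hS := isClopen_cyl (I := I) hA (p.subset_algebra hp)
  exact ⟨_, _, hS.isOpen, hS.compl.isOpen, hp, hq, disjoint_compl_right⟩

theorem exists_eq_cyl (hA : IsSetAlgebra A) (hIA : I ⊆ A) (hI0 : ∅ ∈ I)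
    (hIdown : ∀ S ∈ I, ∀ T ∈ A, T ⊆ S → T ∈ I) (hIcup : ∀ S ∈ I, ∀ T ∈ I, S ∪ T ∈ I)
    {G : Set (IdealUltrafilter A I)} (hG : IsOpen G) (hGc : IsCompact G) :
    ∃ S ∈ I, G = cyl A I S := by
  suffices h : ∃ S ∈ I, G ⊆ cyl A I S ∧ cyl A I S ⊆ G from
    h.imp fun S hS => ⟨hS.1, hS.2.1.antisymm hS.2.2⟩
  refine hGc.induction_on (p := fun K => ∃ S ∈ I, K ⊆ cyl A I S ∧ cyl A I S ⊆ G) ?_ ?_ ?_ ?_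
  · exact ⟨∅, hI0, empty_subset _, by simp [cyl_empty]⟩
  · rintro K L hKL ⟨S, hS, hL, hSG⟩
    exact ⟨S, hS, hKL.trans hL, hSG⟩
  · rintro K L ⟨S, hS, hK, hSG⟩ ⟨T, hT, hL, hTG⟩
    refine ⟨S ∪ T, hIcup S hS T hT, ?_⟩
    rw [cyl_union hA (hIA hS) (hIA hT)]
    exact ⟨union_subset_union hK hL, union_subset hSG hTG⟩
  · intro p hp
    obtain ⟨_, ⟨S, hS, rfl⟩, hpS, hSG⟩ :=
      (isTopologicalBasis_cyl hA hIA hIdown).exists_subset_of_mem_open hp hG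
    exact ⟨_, mem_nhdsWithin_of_mem_nhds ((isOpen_cyl (hIA hS)).mem_nhds hpS), S, hS,
      Subset.rfl, hSG⟩

/-- The ultrafilter of members of `A` containing a given point. -/
def ofPoint (hA : IsSetAlgebra A) (hIA : I ⊆ A) (hI : ⋃₀ I = univ) (x : X) :
    IdealUltrafilter A I where
  carrier := {S | S ∈ A ∧ x ∈ S}
  subset_algebra := fun _ h => h.1
  empty_notMem := fun h => h.2
  inter_mem := fun _ hS _ hT => ⟨hA.inter_mem hS.1 hT.1, hS.2, hT.2⟩
  mem_of_superset := fun _ hS _ hT h => ⟨hT, h hS.2⟩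
  mem_or_compl_mem := fun S hS => (em (x ∈ S)).imp (fun h => ⟨hS, h⟩)
    fun h => ⟨hA.compl_mem hS, h⟩
  exists_mem_ideal :=
    let ⟨S, hS, hx⟩ := mem_sUnion.1 (hI ▸ mem_univ x)
    ⟨S, hS, hIA hS, hx⟩

theorem preimage_ofPoint_cyl (hA : IsSetAlgebra A) (hIA : I ⊆ A) (hI : ⋃₀ I = univ)
    {S : Set X} (hS : S ∈ A) : ofPoint hA hIA hI ⁻¹' cyl A I S = S :=
  ext fun _ => ⟨fun h => h.2, fun h => ⟨hS, h⟩⟩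

theorem isEmbedding_ofPoint [TopologicalSpace X] [T0Space X] (hA : IsSetAlgebra A) (hIA : I ⊆ A)
    (hAclopen : ∀ S ∈ A, IsClopen S) (hI : IsTopologicalBasis I) :
    IsEmbedding (ofPoint hA hIA hI.sUnion_eq) := by
  suffices h : IsInducing (ofPoint hA hIA hI.sUnion_eq) from h.isEmbedding
  refine ⟨le_antisymm ?_ ?_⟩
  · refine continuous_iff_le_induced.1 (continuous_generateFrom_iff.2 ?_)
    rintro _ ⟨S, hS, rfl⟩
    rw [preimage_ofPoint_cyl hA hIA _ hS]
    exact (hAclopen S hS).isOpen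
  · refine (le_generateFrom fun S hS => ?_).trans_eq hI.eq_generateFrom.symm
    exact ⟨_, isOpen_cyl (hIA hS), preimage_ofPoint_cyl hA hIA _ (hIA hS)⟩

theorem denseRange_ofPoint (hA : IsSetAlgebra A) (hIA : I ⊆ A) (hI : ⋃₀ I = univ)
    (hIdown : ∀ S ∈ I, ∀ T ∈ A, T ⊆ S → T ∈ I) : DenseRange (ofPoint hA hIA hI) := by
  refine (isTopologicalBasis_cyl hA hIA hIdown).dense_iff.2 ?_
  rintro _ ⟨S, hS, rfl⟩ ⟨p, hp⟩
  obtain ⟨x, hx⟩ : S.Nonempty := nonempty_iff_ne_empty.2 fun h => p.empty_notMem (h ▸ hp)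
  exact ⟨ofPoint hA hIA hI x, ⟨hIA hS, hx⟩, mem_range_self x⟩

theorem locallyCompactSpace (hA : IsSetAlgebra A) (hIA : I ⊆ A) :
    LocallyCompactSpace (IdealUltrafilter A I) := by
  have := t2Space (I := I) hA
  have : WeaklyLocallyCompactSpace (IdealUltrafilter A I) := by
    refine ⟨fun p => ?_⟩
    obtain ⟨S, hS, hp⟩ := p.exists_mem_ideal
    exact ⟨_, isCompact_cyl hA hIA hS, (isOpen_cyl (hIA hS)).mem_nhds hp⟩
  infer_instance

/-- The members of `I` whose set of ultrafilters lies in `G`. -/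
def idealOf (G : Set (IdealUltrafilter A I)) : Set (Set X) := {S | S ∈ I ∧ cyl A I S ⊆ G}

theorem isIdeal_idealOf (hA : IsSetAlgebra A) (hIA : I ⊆ A) (hI0 : ∅ ∈ I)
    (hIcup : ∀ S ∈ I, ∀ T ∈ I, S ∪ T ∈ I) (G : Set (IdealUltrafilter A I)) :
    ∅ ∈ idealOf G ∧ (∀ S ∈ idealOf G, ∀ T ∈ I, T ⊆ S → T ∈ idealOf G) ∧
      ∀ S ∈ idealOf G, ∀ T ∈ idealOf G, S ∪ T ∈ idealOf G := by
  refine ⟨⟨hI0, by simp [cyl_empty]⟩, fun S hS T hT h => ⟨hT, (cyl_mono (hIA hS.1) h).trans hS.2⟩,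
    fun S hS T hT => ⟨hIcup S hS.1 T hT.1, ?_⟩⟩
  rw [cyl_union hA (hIA hS.1) (hIA hT.1)]
  exact union_subset hS.2 hT.2

theorem disjoint_of_mem_idealOf (hA : IsSetAlgebra A) (hIA : I ⊆ A) (hI : ⋃₀ I = univ)
    {G : Set (IdealUltrafilter A I)} {S T : Set X} (hS : S ∈ idealOf G) (hT : T ∈ idealOf Gᶜ) :
    Disjoint S T := by
  refine disjoint_left.2 fun x hxS hxT => ?_
  have hG : ofPoint hA hIA hI x ∈ G := hS.2 ⟨hIA hS.1, hxS⟩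
  have hGc : ofPoint hA hIA hI x ∈ Gᶜ := hT.2 ⟨hIA hT.1, hxT⟩
  exact hGc hG

theorem idealOf_inter_idealOf_compl (hA : IsSetAlgebra A) (hIA : I ⊆ A) (hI : ⋃₀ I = univ)
    (hI0 : ∅ ∈ I) (G : Set (IdealUltrafilter A I)) : idealOf G ∩ idealOf Gᶜ = {∅} := by
  ext S
  refine ⟨fun h => disjoint_self.1 (disjoint_of_mem_idealOf hA hIA hI h.1 h.2), ?_⟩
  rintro rfl
  exact ⟨⟨hI0, by simp [cyl_empty]⟩, hI0, by simp [cyl_empty]⟩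

theorem exists_union_eq_of_isClopen (hA : IsSetAlgebra A) (hIA : I ⊆ A) (hI : ⋃₀ I = univ)
    (hI0 : ∅ ∈ I) (hIdown : ∀ S ∈ I, ∀ T ∈ A, T ⊆ S → T ∈ I)
    (hIcup : ∀ S ∈ I, ∀ T ∈ I, S ∪ T ∈ I) {G : Set (IdealUltrafilter A I)} (hG : IsClopen G)
    {F : Set X} (hF : F ∈ I) : ∃ a ∈ idealOf G, ∃ b ∈ idealOf Gᶜ, F = a ∪ b := by
  have hFo := isOpen_cyl (I := I) (hIA hF)
  have hFc := isCompact_cyl hA hIA hF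
  obtain ⟨a, ha, hGa⟩ := exists_eq_cyl hA hIA hI0 hIdown hIcup
    (hFo.inter hG.isOpen) (hFc.inter_right hG.isClosed)
  obtain ⟨b, hb, hGb⟩ := exists_eq_cyl hA hIA hI0 hIdown hIcup
    (hFo.inter hG.compl.isOpen) (hFc.inter_right hG.compl.isClosed)
  refine ⟨a, ⟨ha, hGa ▸ inter_subset_right⟩, b, ⟨hb, hGb ▸ inter_subset_right⟩, ?_⟩
  have h : cyl A I F = cyl A I a ∪ cyl A I b := by rw [← hGa, ← hGb, inter_union_compl]
  simpa only [preimage_union, preimage_ofPoint_cyl hA hIA hI (hIA hF),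
    preimage_ofPoint_cyl hA hIA hI (hIA ha), preimage_ofPoint_cyl hA hIA hI (hIA hb)]
    using congrArg (ofPoint hA hIA hI ⁻¹' ·) h

theorem exists_mem_idealOf (hA : IsSetAlgebra A) (hIA : I ⊆ A) (hI : ⋃₀ I = univ)
    (hIdown : ∀ S ∈ I, ∀ T ∈ A, T ⊆ S → T ∈ I) {G : Set (IdealUltrafilter A I)} (hG : IsOpen G)
    {x : X} (hx : ofPoint hA hIA hI x ∈ G) : ∃ S ∈ idealOf G, x ∈ S := by
  obtain ⟨_, ⟨S, hS, rfl⟩, hxS, hSG⟩ :=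
    (isTopologicalBasis_cyl hA hIA hIdown).exists_subset_of_mem_open hx hG
  exact ⟨S, ⟨hS, hSG⟩, hxS.2⟩

theorem preimage_eq_of_isLeast_upperBound (hA : IsSetAlgebra A) (hIA : I ⊆ A) (hI : ⋃₀ I = univ)
    (hIdown : ∀ S ∈ I, ∀ T ∈ A, T ⊆ S → T ∈ I) {G : Set (IdealUltrafilter A I)} (hG : IsClopen G)
    {S : Set X} (hS : S ∈ A) (hub : ∀ T ∈ idealOf G, T ⊆ S)
    (hleast : ∀ S' ∈ A, (∀ T ∈ idealOf G, T ⊆ S') → S ⊆ S') :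
    S = ofPoint hA hIA hI ⁻¹' G := by
  refine Subset.antisymm (fun x hx => ?_) fun x hx => ?_
  · by_contra hxG
    obtain ⟨T, hT, hxT⟩ := exists_mem_idealOf hA hIA hI hIdown hG.compl.isOpen hxG
    refine (hleast (S \ T) (hA.sdiff_mem hS (hIA hT.1)) (fun R hR => ?_) hx).2 hxT
    exact subset_sdiff.2 ⟨hub R hR, disjoint_of_mem_idealOf hA hIA hI hR hT⟩
  · obtain ⟨T, hT, hxT⟩ := exists_mem_idealOf hA hIA hI hIdown hG.isOpen hx
    exact hub T hT hxT

end IdealUltrafilter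

theorem stmt1 {X : Type u} [TopologicalSpace X] [T2Space X]
    (hX : IsTopologicalBasis {s : Set X | IsClopen s})
    (A I : Set (Set X))
    (hAclopen : ∀ S ∈ A, IsClopen S)
    (hA0 : (∅ : Set X) ∈ A) (hA1 : (Set.univ : Set X) ∈ A)
    (hAcup : ∀ S ∈ A, ∀ T ∈ A, S ∪ T ∈ A)
    (hAcap : ∀ S ∈ A, ∀ T ∈ A, S ∩ T ∈ A)
    (hAc : ∀ S ∈ A, Sᶜ ∈ A)
    (hIA : I ⊆ A) (hI0 : (∅ : Set X) ∈ I)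
    (hIdown : ∀ S ∈ I, ∀ T ∈ A, T ⊆ S → T ∈ I)
    (hIcup : ∀ S ∈ I, ∀ T ∈ I, S ∪ T ∈ I)
    (hIbase : IsTopologicalBasis I)
    -- the ZLB condition
    (hZLB : ∀ J ⊆ I,
      ((∅ : Set X) ∈ J ∧ (∀ S ∈ J, ∀ T ∈ I, T ⊆ S → T ∈ J) ∧
        (∀ S ∈ J, ∀ T ∈ J, S ∪ T ∈ J)) →
      (∃ J' ⊆ I,
        ((∅ : Set X) ∈ J' ∧ (∀ S ∈ J', ∀ T ∈ I, T ⊆ S → T ∈ J') ∧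
          (∀ S ∈ J', ∀ T ∈ J', S ∪ T ∈ J')) ∧
        J ∩ J' = {(∅ : Set X)} ∧ (∀ F ∈ I, ∃ a ∈ J, ∃ b ∈ J', F = a ∪ b)) →
      ∃ S ∈ A, (∀ T ∈ J, T ⊆ S) ∧ ∀ S' ∈ A, (∀ T ∈ J, T ⊆ S') → S ⊆ S') :
    ∃ (Y : Type u) (tY : TopologicalSpace Y) (f : X → Y),
      @T2Space Y tY ∧ @LocallyCompactSpace Y tY ∧
      @IsTopologicalBasis Y tY {s : Set Y | @IsClopen Y tY s} ∧
      @IsEmbedding X Y _ tY f ∧ @DenseRange Y tY X f ∧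
      A = {S : Set X | ∃ G : Set Y, @IsClopen Y tY G ∧ S = f ⁻¹' G} ∧
      I = {S : Set X | ∃ G : Set Y, @IsClopen Y tY G ∧ @IsCompact Y tY G ∧ S = f ⁻¹' G} := by
  have hA : IsSetAlgebra A := ⟨hA0, fun S hS => hAc S hS, fun S T hS hT => hAcup S hS T hT⟩
  have hI := hIbase.sUnion_eq
  refine ⟨IdealUltrafilter A I, inferInstance, IdealUltrafilter.ofPoint hA hIA hI,
    IdealUltrafilter.t2Space hA, IdealUltrafilter.locallyCompactSpace hA hIA, ?_,
    IdealUltrafilter.isEmbedding_ofPoint hA hIA hAclopen hIbase,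
    IdealUltrafilter.denseRange_ofPoint hA hIA hI hIdown, ?_, ?_⟩
  · refine (IdealUltrafilter.isTopologicalBasis_cyl hA hIA hIdown).of_isOpen_of_subset
      (fun G hG => hG.isOpen) ?_
    rintro _ ⟨S, hS, rfl⟩
    exact IdealUltrafilter.isClopen_cyl hA (hIA hS)
  · refine Subset.antisymm (fun S hS => ⟨_, IdealUltrafilter.isClopen_cyl hA hS,
      (IdealUltrafilter.preimage_ofPoint_cyl hA hIA hI hS).symm⟩) ?_
    rintro _ ⟨G, hG, rfl⟩
    obtain ⟨S, hS, hub, hleast⟩ := hZLB (IdealUltrafilter.idealOf G) (fun S hS => hS.1)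
      (IdealUltrafilter.isIdeal_idealOf hA hIA hI0 hIcup G)
      ⟨IdealUltrafilter.idealOf Gᶜ, fun S hS => hS.1,
        IdealUltrafilter.isIdeal_idealOf hA hIA hI0 hIcup Gᶜ,
        IdealUltrafilter.idealOf_inter_idealOf_compl hA hIA hI hI0 G,
        fun F hF =>
          IdealUltrafilter.exists_union_eq_of_isClopen hA hIA hI hI0 hIdown hIcup hG hF⟩
    rwa [← IdealUltrafilter.preimage_eq_of_isLeast_upperBound hA hIA hI hIdown hG hS hub hleast]
  · refine Subset.antisymm (fun S hS => ⟨_, IdealUltrafilter.isClopen_cyl hA (hIA hS),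
      IdealUltrafilter.isCompact_cyl hA hIA hS,
      (IdealUltrafilter.preimage_ofPoint_cyl hA hIA hI (hIA hS)).symm⟩) ?_
    rintro _ ⟨G, hG, hGc, rfl⟩
    obtain ⟨S, hS, rfl⟩ :=
      IdealUltrafilter.exists_eq_cyl hA hIA hI0 hIdown hIcup hG.isOpen hGc
    rwa [IdealUltrafilter.preimage_ofPoint_cyl hA hIA hI (hIA hS)]
end

section
/- Let X be a zero-dimensional Hausdorff topological space and let (Y, f) and (Y', f') be two extensions of X with Y and Y' zero-dimensional locally compact Hausdorff spaces. If {f⁻¹(G) : G clopen in Y} = {f'⁻¹(G) : G clopen in Y'} and {f⁻¹(G) : G compact clopen in Y} = {f'⁻¹(G) : G compact clopen in Y'}, then there exists a homeomorphism h : Y → Y' such that h ∘ f = f'. -/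
open Topology TopologicalSpace Set Filter

/-- A map `f'` into a zero-dimensional space has a limit along the trace of each neighbourhood
filter of a dense map `f` into a zero-dimensional locally compact space, provided traces of clopen
sets of the target are traces of clopen sets of the source, and traces of compact clopen sets of
the source are traces of compact sets of the target. -/
theorem exists_tendsto_comap_nhds_of_clopen_traces {X Y Y' : Type*}
    [TopologicalSpace Y] [LocallyCompactSpace Y] [T2Space Y]
    (hY : IsTopologicalBasis {s : Set Y | IsClopen s})
    [TopologicalSpace Y'] (hY' : IsTopologicalBasis {s : Set Y' | IsClopen s})
    {f : X → Y} (hfd : DenseRange f) {f' : X → Y'}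
    (hA : ∀ G' : Set Y', IsClopen G' → ∃ G : Set Y, IsClopen G ∧ f' ⁻¹' G' = f ⁻¹' G)
    (hI : ∀ G : Set Y, IsClopen G → IsCompact G →
      ∃ G' : Set Y', IsCompact G' ∧ f ⁻¹' G = f' ⁻¹' G') (y : Y) :
    ∃ c, Tendsto f' (comap f (𝓝 y)) (𝓝 c) := by
  obtain ⟨C, hC, hyC⟩ := exists_compact_mem_nhds y
  obtain ⟨K, hK, hyK, hKC⟩ := hY.mem_nhds_iff.1 hyC
  obtain ⟨K', hK', hKK'⟩ := hI K hK (hC.of_isClosed_subset hK.isClosed hKC)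
  have : (comap f (𝓝 y)).NeBot := comap_neBot fun _ => hfd.mem_nhds
  have hle : map f' (comap f (𝓝 y)) ≤ 𝓟 K' := by
    rw [le_principal_iff, mem_map, ← hKK']
    exact preimage_mem_comap (hK.isOpen.mem_nhds hyK)
  obtain ⟨c, -, hc⟩ := hK' hle
  refine ⟨c, hY'.nhds_hasBasis.tendsto_right_iff.2 fun G' ⟨hG', hcG'⟩ => ?_⟩
  obtain ⟨G, hG, hGG'⟩ := hA G' hG'
  change f' ⁻¹' G' ∈ comap f (𝓝 y)
  rw [hGG']
  refine preimage_mem_comap (hG.isOpen.mem_nhds ?_)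
  by_contra hyG
  have hmem : G'ᶜ ∈ map f' (comap f (𝓝 y)) := by
    rw [mem_map, preimage_compl, hGG', ← preimage_compl]
    exact preimage_mem_comap (hG.compl.isOpen.mem_nhds hyG)
  obtain ⟨z, hz, hz'⟩ := clusterPt_iff_nonempty.1 hc (hG'.isOpen.mem_nhds hcG') hmem
  exact hz' hz


theorem stmt2 {X Y Y' : Type*} [TopologicalSpace X] [T2Space X]
    (hX : IsTopologicalBasis {s : Set X | IsClopen s})
    [TopologicalSpace Y] [T2Space Y] [LocallyCompactSpace Y]
    (hY : IsTopologicalBasis {s : Set Y | IsClopen s})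
    [TopologicalSpace Y'] [T2Space Y'] [LocallyCompactSpace Y']
    (hY' : IsTopologicalBasis {s : Set Y' | IsClopen s})
    (f : X → Y) (hf : IsEmbedding f) (hfd : DenseRange f)
    (f' : X → Y') (hf' : IsEmbedding f') (hf'd : DenseRange f')
    (hA : {S : Set X | ∃ G : Set Y, IsClopen G ∧ S = f ⁻¹' G} =
          {S : Set X | ∃ G : Set Y', IsClopen G ∧ S = f' ⁻¹' G})
    (hI : {S : Set X | ∃ G : Set Y, IsClopen G ∧ IsCompact G ∧ S = f ⁻¹' G} =
          {S : Set X | ∃ G : Set Y', IsClopen G ∧ IsCompact G ∧ S = f' ⁻¹' G}) :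
    ∃ h : Y ≃ₜ Y', ∀ x : X, h (f x) = f' x := by
  have di : IsDenseInducing f := ⟨hf.isInducing, hfd⟩
  have di' : IsDenseInducing f' := ⟨hf'.isInducing, hf'd⟩
  have lim := exists_tendsto_comap_nhds_of_clopen_traces hY hY' hfd (f' := f')
    (fun G' hG' => hA.ge ⟨G', hG', rfl⟩)
    (fun G hG hGc => let ⟨G', _, h⟩ := hI.le ⟨G, hG, hGc, rfl⟩; ⟨G', h⟩)
  have lim' := exists_tendsto_comap_nhds_of_clopen_traces hY' hY hf'd (f' := f)
    (fun G hG => hA.le ⟨G, hG, rfl⟩)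
    (fun G' hG' hGc => let ⟨G, _, h⟩ := hI.ge ⟨G', hG', hGc, rfl⟩; ⟨G, h⟩)
  have hg := di.continuous_extend lim
  have hg' := di'.continuous_extend lim'
  have hgf := di.extend_eq' lim
  have hgf' := di'.extend_eq' lim'
  refine ⟨⟨⟨di.extend f', di'.extend f, ?_, ?_⟩, hg, hg'⟩, hgf⟩
  · exact congrFun (hfd.equalizer (hg'.comp hg) continuous_id (by ext x; simp [hgf, hgf']))
  · exact congrFun (hf'd.equalizer (hg.comp hg') continuous_id (by ext x; simp [hgf, hgf']))
end

section
/- Let X be a zero-dimensional Hausdorff topological space and let (Y₁, f₁) and (Y₂, f₂) be two extensions of X with Y₁ and Y₂ zero-dimensional locally compact Hausdorff spaces. For i = 1, 2 set Aᵢ = {fᵢ⁻¹(G) : G clopen in Yᵢ} and Iᵢ = {fᵢ⁻¹(G) : G compact clopen in Yᵢ}. Then there exists a continuous map h : Y₂ → Y₁ with h ∘ f₂ = f₁ if and only if A₁ ⊆ A₂ and for every V ∈ I₂ there exists U ∈ I₁ with V ⊆ U. -/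
open Topology TopologicalSpace Set

/-- In a locally compact space with a base of clopen sets, every compact set is contained
in a compact clopen set. -/
theorem exists_isClopen_isCompact_superset {Y : Type*} [TopologicalSpace Y] [LocallyCompactSpace Y]
    (hY : IsTopologicalBasis {s : Set Y | IsClopen s}) {K : Set Y} (hK : IsCompact K) :
    ∃ G : Set Y, IsClopen G ∧ IsCompact G ∧ K ⊆ G := by
  refine hK.induction_on (p := fun K => ∃ G : Set Y, IsClopen G ∧ IsCompact G ∧ K ⊆ G)
    ⟨∅, isClopen_empty, isCompact_empty, subset_rfl⟩ ?_ ?_ ?_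
  · rintro s t hst ⟨G, hG, hGc, htG⟩
    exact ⟨G, hG, hGc, hst.trans htG⟩
  · rintro s t ⟨G, hG, hGc, hsG⟩ ⟨G', hG', hGc', htG⟩
    exact ⟨G ∪ G', hG.union hG', hGc.union hGc', union_subset_union hsG htG⟩
  · intro x _
    obtain ⟨L, hL, hxL⟩ := exists_compact_mem_nhds x
    obtain ⟨G, hG, hxG, hGL⟩ := hY.mem_nhds_iff.1 hxL
    exact ⟨G, mem_nhdsWithin_of_mem_nhds (hG.isOpen.mem_nhds hxG), G, hG,
      hL.of_isClosed_subset hG.isClosed hGL, subset_rfl⟩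

/-- A filter converges to a cluster point `z` if it decides every clopen neighbourhood of `z`. -/
theorem ClusterPt.le_nhds_of_isClopen {Y : Type*} [TopologicalSpace Y]
    (hY : IsTopologicalBasis {s : Set Y | IsClopen s}) {F : Filter Y} {z : Y} (hz : ClusterPt z F)
    (hF : ∀ C : Set Y, IsClopen C → C ∈ F ∨ Cᶜ ∈ F) : F ≤ 𝓝 z := by
  intro s hs
  obtain ⟨C, hC, hzC, hCs⟩ := hY.mem_nhds_iff.1 hs
  refine Filter.mem_of_superset ((hF C hC).resolve_right fun hC' => ?_) hCs
  obtain ⟨w, hw, hw'⟩ := clusterPt_iff_nonempty.1 hz (hC.isOpen.mem_nhds hzC) hC'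
  exact hw' hw

theorem stmt3 {X Y₁ Y₂ : Type*} [TopologicalSpace X] [T2Space X]
    (hX : IsTopologicalBasis {s : Set X | IsClopen s})
    [TopologicalSpace Y₁] [T2Space Y₁] [LocallyCompactSpace Y₁]
    (hY₁ : IsTopologicalBasis {s : Set Y₁ | IsClopen s})
    [TopologicalSpace Y₂] [T2Space Y₂] [LocallyCompactSpace Y₂]
    (hY₂ : IsTopologicalBasis {s : Set Y₂ | IsClopen s})
    (f₁ : X → Y₁) (hf₁ : IsEmbedding f₁) (hd₁ : DenseRange f₁)
    (f₂ : X → Y₂) (hf₂ : IsEmbedding f₂) (hd₂ : DenseRange f₂)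
    (A₁ I₁ A₂ I₂ : Set (Set X))
    (hA₁ : A₁ = {S : Set X | ∃ G : Set Y₁, IsClopen G ∧ S = f₁ ⁻¹' G})
    (hI₁ : I₁ = {S : Set X | ∃ G : Set Y₁, IsClopen G ∧ IsCompact G ∧ S = f₁ ⁻¹' G})
    (hA₂ : A₂ = {S : Set X | ∃ G : Set Y₂, IsClopen G ∧ S = f₂ ⁻¹' G})
    (hI₂ : I₂ = {S : Set X | ∃ G : Set Y₂, IsClopen G ∧ IsCompact G ∧ S = f₂ ⁻¹' G}) :
    (∃ h : Y₂ → Y₁, Continuous h ∧ ∀ x : X, h (f₂ x) = f₁ x) ↔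
      (A₁ ⊆ A₂ ∧ ∀ V ∈ I₂, ∃ U ∈ I₁, V ⊆ U) := by
  subst hA₁ hI₁ hA₂ hI₂
  constructor
  · rintro ⟨h, hc, hh⟩
    constructor
    · rintro _ ⟨G, hG, rfl⟩
      refine ⟨h ⁻¹' G, hG.preimage hc, ?_⟩
      ext x
      simp [hh]
    · rintro _ ⟨G, -, hGc, rfl⟩
      obtain ⟨H, hH, hHc, hGH⟩ := exists_isClopen_isCompact_superset hY₁ (hGc.image hc)
      refine ⟨f₁ ⁻¹' H, ⟨H, hH, hHc, rfl⟩, fun x hx => ?_⟩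
      have : h (f₂ x) ∈ H := hGH (mem_image_of_mem h hx)
      rwa [hh] at this
  · rintro ⟨hA, hI⟩
    have di : IsDenseInducing f₂ := ⟨hf₂.isInducing, hd₂⟩
    have hlim (y : Y₂) : ∃ z, Filter.Tendsto f₁ (Filter.comap f₂ (𝓝 y)) (𝓝 z) := by
      obtain ⟨W, hW, hWc, hyW⟩ :=
        exists_isClopen_isCompact_superset hY₂ (isCompact_singleton (x := y))
      obtain ⟨_, ⟨G, -, hGc, rfl⟩, hWG⟩ := hI _ ⟨W, hW, hWc, rfl⟩
      have := di.comap_nhds_neBot y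
      have hG : Filter.map f₁ (Filter.comap f₂ (𝓝 y)) ≤ Filter.principal G :=
        Filter.le_principal_iff.2 ⟨W, hW.isOpen.mem_nhds (hyW rfl), hWG⟩
      obtain ⟨z, -, hz⟩ := hGc hG
      refine ⟨z, hz.le_nhds_of_isClopen hY₁ fun C hC => ?_⟩
      obtain ⟨D, hD, hCD⟩ := hA ⟨C, hC, rfl⟩
      by_cases hy : y ∈ D
      · exact .inl ⟨D, hD.isOpen.mem_nhds hy, hCD.ge⟩
      · refine .inr ⟨Dᶜ, hD.compl.isOpen.mem_nhds hy, ?_⟩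
        rw [preimage_compl, preimage_compl, hCD]
    exact ⟨di.extend f₁, di.continuous_extend hlim, fun x => di.extend_eq hf₁.continuous x⟩
end

section
/- Let X be a zero-dimensional Hausdorff topological space and let A be a Boolean subalgebra of the Boolean algebra CO(X) of clopen subsets of X which is an open base of the topology of X. Then there exist a compact Hausdorff zero-dimensional space Y and a topological embedding f : X → Y with dense image such that A = {f⁻¹(G) : G clopen in Y}; moreover, such an extension is unique up to equivalence: if (Y', f') is another extension with Y' compact Hausdorff zero-dimensional and A = {f'⁻¹(G) : G clopen in Y'}, then there is a homeomorphism h : Y → Y' with h ∘ f = f'. -/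
open Topology TopologicalSpace Set

universe u

/-- In a compact space, a family of clopen sets that is closed under the Boolean operations and
separates points contains every clopen set. -/
theorem mem_of_isClopen_of_separating {Y : Type*} [TopologicalSpace Y] [CompactSpace Y]
    {C : Set (Set Y)} (hC : ∀ S ∈ C, IsClopen S) (h0 : ∅ ∈ C)
    (hcup : ∀ S ∈ C, ∀ T ∈ C, S ∪ T ∈ C) (hc : ∀ S ∈ C, Sᶜ ∈ C)
    (hsep : ∀ x y, x ≠ y → ∃ S ∈ C, x ∈ S ∧ y ∉ S) {K : Set Y} (hK : IsClopen K) : K ∈ C := by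
  have point : ∀ x ∈ K, ∃ T ∈ C, x ∈ T ∧ T ⊆ K := by
    intro x hx
    have key : ∃ T ∈ C, Kᶜ ⊆ T ∧ x ∉ T := by
      refine hK.compl.isClosed.isCompact.induction_on (p := fun s => ∃ T ∈ C, s ⊆ T ∧ x ∉ T)
        ⟨∅, h0, by simp, by simp⟩ ?_ ?_ ?_
      · rintro s t hst ⟨T, hT, htT, hxT⟩
        exact ⟨T, hT, hst.trans htT, hxT⟩
      · rintro s t ⟨T, hT, hsT, hxT⟩ ⟨U, hU, htU, hxU⟩
        exact ⟨T ∪ U, hcup T hT U hU, union_subset_union hsT htU, by simp [hxT, hxU]⟩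
      · intro y hy
        obtain ⟨S, hS, hyS, hxS⟩ := hsep y x (by rintro rfl; exact hy hx)
        exact ⟨S, mem_nhdsWithin_of_mem_nhds ((hC S hS).isOpen.mem_nhds hyS), S, hS,
          Subset.rfl, hxS⟩
    obtain ⟨T, hT, hKT, hxT⟩ := key
    exact ⟨Tᶜ, hc T hT, hxT, compl_subset_comm.1 hKT⟩
  have key : ∃ T ∈ C, K ⊆ T ∧ T ⊆ K := by
    refine hK.isClosed.isCompact.induction_on (p := fun s => ∃ T ∈ C, s ⊆ T ∧ T ⊆ K)
      ⟨∅, h0, by simp, by simp⟩ ?_ ?_ ?_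
    · rintro s t hst ⟨T, hT, htT, hTK⟩
      exact ⟨T, hT, hst.trans htT, hTK⟩
    · rintro s t ⟨T, hT, hsT, hTK⟩ ⟨U, hU, htU, hUK⟩
      exact ⟨T ∪ U, hcup T hT U hU, union_subset_union hsT htU, union_subset hTK hUK⟩
    · intro x hx
      obtain ⟨T, hT, hxT, hTK⟩ := point x hx
      exact ⟨T, mem_nhdsWithin_of_mem_nhds ((hC T hT).isOpen.mem_nhds hxT), T, hT,
        Subset.rfl, hTK⟩
  obtain ⟨T, hT, hKT, hTK⟩ := key
  rwa [hKT.antisymm hTK]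

/-- A clopen set is determined by its trace on a dense subspace. -/
theorem IsClopen.eq_of_preimage_eq {X Y : Type*} [TopologicalSpace Y] {f : X → Y}
    (hf : DenseRange f) {G H : Set Y} (hG : IsClopen G) (hH : IsClopen H)
    (h : f ⁻¹' G = f ⁻¹' H) : G = H := by
  have key : ∀ {U V : Set Y}, IsOpen U → IsClosed V → f ⁻¹' U = f ⁻¹' V → U ⊆ V := by
    intro U V hU hV hUV
    refine (Dense.open_subset_closure_inter hf hU).trans (closure_minimal ?_ hV)
    rintro _ ⟨hx, x, rfl⟩
    exact hUV.subset hx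
  exact (key hG.isOpen hH.isClosed h).antisymm (key hH.isOpen hG.isClosed h.symm)

open Classical in
/-- The map sending a point to the indicator function of the members of `A` containing it. -/
noncomputable def indicatorMap {X : Type*} (A : Set (Set X)) (x : X) : A → Bool :=
  fun S => decide (x ∈ S.1)

theorem indicatorMap_preimage {X : Type*} (A : Set (Set X)) (S : A) :
    indicatorMap A ⁻¹' {p | p S = true} = S.1 := by
  ext x
  simp [indicatorMap]

theorem isClopen_setOf_apply_eq_true {ι : Type*} (i : ι) :
    IsClopen {p : ι → Bool | p i = true} :=
  (isClopen_discrete {true}).preimage (continuous_apply i)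

theorem isEmbedding_indicatorMap {X : Type*} [TopologicalSpace X] [T0Space X] {A : Set (Set X)}
    (hA : ∀ S ∈ A, IsClopen S) (hbase : IsTopologicalBasis A) :
    IsEmbedding (indicatorMap A) := by
  refine IsInducing.isEmbedding ⟨le_antisymm ?_ ?_⟩
  · rw [← continuous_iff_le_induced]
    refine continuous_pi fun S => ?_
    refine continuous_bool_rng true |>.2 ?_
    change IsClopen (indicatorMap A ⁻¹' {p | p S = true})
    rw [indicatorMap_preimage]
    exact hA _ S.2
  · rw [hbase.eq_generateFrom]
    refine le_generateFrom fun S hS => ?_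
    exact ⟨{p | p ⟨S, hS⟩ = true}, (isClopen_setOf_apply_eq_true _).isOpen,
      indicatorMap_preimage A ⟨S, hS⟩⟩

/-- A compact zero-dimensional extension of `X` whose clopen sets have traces `A` is homeomorphic,
over `X`, to the closure of the image of `indicatorMap A`. -/
theorem exists_homeomorph_closure_range_indicatorMap {X Y : Type*} [TopologicalSpace Y]
    [T2Space Y] [CompactSpace Y] (hY : IsTopologicalBasis {s : Set Y | IsClopen s})
    {A : Set (Set X)} {f : X → Y} (hf : DenseRange f)
    (hA : A = {S | ∃ G, IsClopen G ∧ S = f ⁻¹' G}) :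
    ∃ g : Y ≃ₜ closure (range (indicatorMap A)), ∀ x, (g (f x) : A → Bool) = indicatorMap A x := by
  classical
  have hex : ∀ S : A, ∃ G, IsClopen G ∧ S.1 = f ⁻¹' G := fun S => hA.subset S.2
  choose G hG hSG using hex
  let e : Y → A → Bool := fun y S => decide (y ∈ G S)
  have hef : ∀ x, e (f x) = indicatorMap A x := by
    intro x
    funext S
    simp only [e, indicatorMap, hSG S, mem_preimage]
  have he : Continuous e := by
    refine continuous_pi fun S => continuous_bool_rng true |>.2 ?_
    convert hG S
    ext y
    simp [e]
  have hinj : Function.Injective e := by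
    intro y z hyz
    by_contra hne
    obtain ⟨H, hH, hyH, hHz⟩ := hY.exists_subset_of_mem_open
      (show y ∈ ({z}ᶜ : Set Y) from hne) isOpen_compl_singleton
    have hmem : f ⁻¹' H ∈ A := hA.symm.subset ⟨H, hH, rfl⟩
    have hGH : G ⟨f ⁻¹' H, hmem⟩ = H :=
      (hG _).eq_of_preimage_eq hf hH (hSG ⟨f ⁻¹' H, hmem⟩).symm
    have := congrFun hyz ⟨f ⁻¹' H, hmem⟩
    simp only [e, hGH, decide_eq_decide] at this
    exact hHz (this.1 hyH) rfl
  have hclosed := he.isClosedEmbedding hinj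
  have hrange : range e = closure (range (indicatorMap A)) := by
    have : range (indicatorMap A) = e '' range f := by
      rw [← range_comp]
      exact congrArg range (funext fun x => (hef x).symm)
    rw [this, hclosed.closure_image_eq, hf.closure_range, image_univ]
  exact ⟨hclosed.isEmbedding.toHomeomorph.trans (Homeomorph.setCongr hrange), hef⟩

theorem stmt4 {X : Type u} [TopologicalSpace X] [T2Space X]
    (hX : IsTopologicalBasis {s : Set X | IsClopen s})
    (A : Set (Set X))
    (hAclopen : ∀ S ∈ A, IsClopen S)
    (hA0 : (∅ : Set X) ∈ A) (hA1 : (Set.univ : Set X) ∈ A)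
    (hAcup : ∀ S ∈ A, ∀ T ∈ A, S ∪ T ∈ A)
    (hAcap : ∀ S ∈ A, ∀ T ∈ A, S ∩ T ∈ A)
    (hAc : ∀ S ∈ A, Sᶜ ∈ A)
    (hAbase : IsTopologicalBasis A) :
    ∃ (Y : Type u) (tY : TopologicalSpace Y) (f : X → Y),
      @T2Space Y tY ∧ @CompactSpace Y tY ∧
      @IsTopologicalBasis Y tY {s : Set Y | @IsClopen Y tY s} ∧
      @IsEmbedding X Y _ tY f ∧ @DenseRange Y tY X f ∧
      A = {S : Set X | ∃ G : Set Y, @IsClopen Y tY G ∧ S = f ⁻¹' G} ∧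
      ∀ (Y' : Type u) (tY' : TopologicalSpace Y') (f' : X → Y'),
        @T2Space Y' tY' → @CompactSpace Y' tY' →
        @IsTopologicalBasis Y' tY' {s : Set Y' | @IsClopen Y' tY' s} →
        @IsEmbedding X Y' _ tY' f' → @DenseRange Y' tY' X f' →
        A = {S : Set X | ∃ G : Set Y', @IsClopen Y' tY' G ∧ S = f' ⁻¹' G} →
        ∃ h : Y → Y', @IsHomeomorph Y Y' tY tY' h ∧ ∀ x : X, h (f x) = f' x := by
  have hemb := isEmbedding_indicatorMap hAclopen hAbase
  let Y := closure (range (indicatorMap A))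
  have : CompactSpace Y := isCompact_iff_compactSpace.1 isClosed_closure.isCompact
  let f : X → Y := fun x => ⟨indicatorMap A x, subset_closure (mem_range_self x)⟩
  have hclopen : ∀ S : A, IsClopen {y : Y | y.1 S = true} := fun S =>
    (isClopen_setOf_apply_eq_true S).preimage continuous_subtype_val
  have htrace : ∀ S : A, f ⁻¹' {y : Y | y.1 S = true} = S.1 := indicatorMap_preimage A
  have hdense : DenseRange f := by
    rw [DenseRange, Subtype.dense_iff, ← range_comp]
    exact Subset.rfl
  refine ⟨Y, inferInstance, f, inferInstance, inferInstance, isTopologicalBasis_isClopen,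
    hemb.codRestrict _ _, hdense, ?_, ?_⟩
  · ext S
    refine ⟨fun hS => ⟨_, hclopen ⟨S, hS⟩, (htrace ⟨S, hS⟩).symm⟩, ?_⟩
    rintro ⟨G, hG, rfl⟩
    refine (mem_of_isClopen_of_separating (C := {G : Set Y | IsClopen G ∧ f ⁻¹' G ∈ A})
      (fun _ h => h.1) ⟨isClopen_empty, hA0⟩
      (fun S hS T hT => ⟨hS.1.union hT.1, hAcup _ hS.2 _ hT.2⟩)
      (fun S hS => ⟨hS.1.compl, hAc _ hS.2⟩) ?_ hG).2
    intro y z hyz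
    obtain ⟨S, hS⟩ := Function.ne_iff.1 (Subtype.coe_injective.ne hyz)
    have hmem : {y : Y | y.1 S = true} ∈ {G : Set Y | IsClopen G ∧ f ⁻¹' G ∈ A} :=
      ⟨hclopen S, (htrace S).symm ▸ S.2⟩
    by_cases hy : y.1 S = true
    · exact ⟨_, hmem, hy, fun hz => hS (hy.trans (Eq.symm hz))⟩
    · refine ⟨_, ⟨hmem.1.compl, hAc _ hmem.2⟩, hy, fun hz => hS ?_⟩
      exact (Bool.eq_false_of_not_eq_true hy).trans (Bool.eq_false_of_not_eq_true hz).symm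
  · intro Y' tY' f' _ _ hY' _ hf' hA'
    obtain ⟨g, hg⟩ := exists_homeomorph_closure_range_indicatorMap hY' hf' hA'
    refine ⟨g.symm, g.symm.isHomeomorph, fun x => ?_⟩
    rw [g.symm_apply_eq]
    exact Subtype.ext (hg x).symm
end

section
/- Let Y be a zero-dimensional locally compact Hausdorff space, let X be a topological space, and let f : X → Y be a topological embedding with dense image. Let A, B ⊆ X be such that cl_Y(f(A)) and cl_Y(f(B)) are compact and cl_Y(f(A)) ∩ cl_Y(f(X \ B)) = ∅. Then there exists a set C ⊆ X with A ⊆ C ⊆ B such that cl_Y(f(C)) ∩ cl_Y(f(X \ C)) = ∅ (equivalently, cl_Y(f(C)) is a compact clopen subset of Y). -/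
open Topology TopologicalSpace Set

/-- In a space with a base of clopen sets, a compact set inside an open set can be separated from
its complement by a clopen set. -/
theorem IsCompact.exists_isClopen_between {Y : Type*} [TopologicalSpace Y]
    (hY : IsTopologicalBasis {s : Set Y | IsClopen s}) {K U : Set Y}
    (hK : IsCompact K) (hU : IsOpen U) (hKU : K ⊆ U) :
    ∃ V, IsClopen V ∧ K ⊆ V ∧ V ⊆ U := by
  refine hK.induction_on (p := fun s ↦ ∃ V, IsClopen V ∧ s ⊆ V ∧ V ⊆ U) ?_ ?_ ?_ ?_
  · exact ⟨∅, isClopen_empty, Subset.rfl, empty_subset U⟩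
  · rintro s t hst ⟨V, hV, htV, hVU⟩
    exact ⟨V, hV, hst.trans htV, hVU⟩
  · rintro s t ⟨V, hV, hsV, hVU⟩ ⟨W, hW, htW, hWU⟩
    exact ⟨V ∪ W, hV.union hW, union_subset_union hsV htW, union_subset hVU hWU⟩
  · intro x hx
    obtain ⟨V, hV, hxV, hVU⟩ := hY.exists_subset_of_mem_open (hKU hx) hU
    exact ⟨V, mem_nhdsWithin_of_mem_nhds (hV.isOpen.mem_nhds hxV), V, hV, Subset.rfl, hVU⟩

theorem stmt5 {X Y : Type*} [TopologicalSpace X]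
    [TopologicalSpace Y] [T2Space Y] [LocallyCompactSpace Y]
    (hY : IsTopologicalBasis {s : Set Y | IsClopen s})
    (f : X → Y) (hf : IsEmbedding f) (hd : DenseRange f)
    (A B : Set X)
    (hA : IsCompact (closure (f '' A)))
    (hB : IsCompact (closure (f '' B)))
    (hAB : closure (f '' A) ∩ closure (f '' Bᶜ) = ∅) :
    ∃ C : Set X, A ⊆ C ∧ C ⊆ B ∧ closure (f '' C) ∩ closure (f '' Cᶜ) = ∅ := by
  obtain ⟨V, hV, hAV, hVB⟩ := hA.exists_isClopen_between hY
    isClosed_closure.isOpen_compl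
    (subset_compl_iff_disjoint_right.mpr (disjoint_iff_inter_eq_empty.mpr hAB))
  refine ⟨f ⁻¹' V, fun a ha ↦ hAV (subset_closure (mem_image_of_mem f ha)), fun x hx ↦ ?_, ?_⟩
  · by_contra hxB
    exact hVB hx (subset_closure (mem_image_of_mem f hxB))
  · have hC : closure (f '' (f ⁻¹' V)) ⊆ V :=
      closure_minimal (image_preimage_subset f V) hV.isClosed
    have hC' : closure (f '' (f ⁻¹' V)ᶜ) ⊆ Vᶜ :=
      closure_minimal (image_preimage_subset f Vᶜ) hV.compl.isClosed
    exact (disjoint_compl_right.mono hC hC').inter_eq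
end

section
/- Let Y be a locally compact Hausdorff space, let X be a topological space, and let f : X → Y be a topological embedding with dense image. Assume that for all A, B ⊆ X such that cl_Y(f(A)) and cl_Y(f(B)) are compact and cl_Y(f(A)) ∩ cl_Y(f(X \ B)) = ∅, there exists a set C ⊆ X with A ⊆ C ⊆ B, cl_Y(f(C)) compact, and cl_Y(f(C)) ∩ cl_Y(f(X \ C)) = ∅. Then Y is zero-dimensional. -/
open Topology TopologicalSpace Set

theorem stmt6 {X Y : Type*} [TopologicalSpace X]
    [TopologicalSpace Y] [T2Space Y] [LocallyCompactSpace Y]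
    (f : X → Y) (hf : IsEmbedding f) (hd : DenseRange f)
    (h : ∀ A B : Set X, IsCompact (closure (f '' A)) → IsCompact (closure (f '' B)) →
      closure (f '' A) ∩ closure (f '' Bᶜ) = ∅ →
      ∃ C : Set X, A ⊆ C ∧ C ⊆ B ∧ IsCompact (closure (f '' C)) ∧
        closure (f '' C) ∩ closure (f '' Cᶜ) = ∅) :
    IsTopologicalBasis {s : Set Y | IsClopen s} := by
  refine isTopologicalBasis_of_isOpen_of_nhds (fun s hs ↦ hs.isOpen) fun y U hyU hU ↦ ?_
  obtain ⟨K, hK, hyK, hKU⟩ := exists_compact_subset hU hyU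
  obtain ⟨L, hL, hyL, hLK⟩ := exists_compact_subset isOpen_interior hyK
  have hA : closure (f '' (f ⁻¹' interior L)) ⊆ L :=
    closure_minimal ((image_preimage_subset _ _).trans interior_subset) hL.isClosed
  have hB : closure (f '' (f ⁻¹' K)) ⊆ K :=
    closure_minimal (image_preimage_subset _ _) hK.isClosed
  have hBc : closure (f '' (f ⁻¹' K)ᶜ) ⊆ (interior K)ᶜ := by
    rw [← closure_compl, ← preimage_compl]
    exact closure_mono (image_preimage_subset _ _)
  obtain ⟨C, hAC, hCB, -, hC⟩ := h (f ⁻¹' interior L) (f ⁻¹' K)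
    (hL.of_isClosed_subset isClosed_closure hA) (hK.of_isClosed_subset isClosed_closure hB)
    (eq_empty_of_forall_notMem fun z hz ↦ hBc hz.2 (hLK (hA hz.1)))
  have hunion : closure (f '' C) ∪ closure (f '' Cᶜ) = univ := by
    rw [← closure_union, ← image_union, union_compl_self, image_univ, hd.closure_range]
  have hcompl : IsCompl (closure (f '' C)) (closure (f '' Cᶜ)) :=
    ⟨disjoint_iff_inter_eq_empty.2 hC, codisjoint_iff.2 hunion⟩
  refine ⟨closure (f '' C), ⟨isClosed_closure, ?_⟩, ?_, ?_⟩
  · rw [← isClosed_compl_iff, hcompl.compl_eq]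
    exact isClosed_closure
  · refine closure_mono (image_mono hAC) ?_
    rw [image_preimage_eq_inter_range]
    exact hd.open_subset_closure_inter isOpen_interior hyL
  · exact (closure_mono (image_mono hCB)).trans (hB.trans hKU)
end

section
/- Let X₁ and X₂ be zero-dimensional Hausdorff spaces, and for i = 1, 2 let fᵢ : Xᵢ → Yᵢ be a topological embedding with dense image into a compact Hausdorff zero-dimensional space Yᵢ. Set Aᵢ = {fᵢ⁻¹(G) : G clopen in Yᵢ}. Let f : X₁ → X₂ be an arbitrary function. Then there exists a continuous map g : Y₁ → Y₂ with g ∘ f₁ = f₂ ∘ f if and only if for every G ∈ A₂ one has f⁻¹(G) ∈ A₁. -/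
open Topology TopologicalSpace Set

/-- If the preimage under `h` of every clopen set is the trace along `i` of a clopen set, then `h`
has a limit along the trace of every neighborhood filter. -/
theorem exists_tendsto_comap_nhds_of_isClopen {X Y Z : Type*} [TopologicalSpace Y]
    [TopologicalSpace Z] [CompactSpace Z]
    (hZ : IsTopologicalBasis {s : Set Z | IsClopen s})
    {i : X → Y} (hi : DenseRange i) {h : X → Z}
    (hh : ∀ G : Set Z, IsClopen G → ∃ H : Set Y, IsClopen H ∧ h ⁻¹' G = i ⁻¹' H) (b : Y) :
    ∃ c, Filter.Tendsto h (Filter.comap i (𝓝 b)) (𝓝 c) := by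
  have : (Filter.comap i (𝓝 b)).NeBot :=
    Filter.comap_neBot fun s hs => by
      obtain ⟨_, hs, a, rfl⟩ := mem_closure_iff_nhds.1 (hi b) s hs
      exact ⟨a, hs⟩
  obtain ⟨c, hc⟩ := exists_clusterPt_of_compactSpace (Filter.map h (Filter.comap i (𝓝 b)))
  refine ⟨c, hZ.nhds_hasBasis.tendsto_right_iff.2 ?_⟩
  rintro G ⟨hG, hcG⟩
  obtain ⟨H, hH, hGH⟩ := hh G hG
  by_cases hb : b ∈ H
  · change h ⁻¹' G ∈ Filter.comap i (𝓝 b)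
    exact hGH ▸ Filter.preimage_mem_comap (hH.isOpen.mem_nhds hb)
  · have hGc : Gᶜ ∈ Filter.map h (Filter.comap i (𝓝 b)) := by
      rw [Filter.mem_map, preimage_compl, hGH, ← preimage_compl]
      exact Filter.preimage_mem_comap (hH.compl.isOpen.mem_nhds hb)
    obtain ⟨z, hz, hz'⟩ := clusterPt_iff_nonempty.1 hc (hG.isOpen.mem_nhds hcG) hGc
    exact absurd hz hz'

theorem stmt8 {X₁ X₂ Y₁ Y₂ : Type*}
    [TopologicalSpace X₁] [T2Space X₁]
    (hX₁ : IsTopologicalBasis {s : Set X₁ | IsClopen s})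
    [TopologicalSpace X₂] [T2Space X₂]
    (hX₂ : IsTopologicalBasis {s : Set X₂ | IsClopen s})
    [TopologicalSpace Y₁] [T2Space Y₁] [CompactSpace Y₁]
    (hY₁ : IsTopologicalBasis {s : Set Y₁ | IsClopen s})
    [TopologicalSpace Y₂] [T2Space Y₂] [CompactSpace Y₂]
    (hY₂ : IsTopologicalBasis {s : Set Y₂ | IsClopen s})
    (f₁ : X₁ → Y₁) (hf₁ : IsEmbedding f₁) (hd₁ : DenseRange f₁)
    (f₂ : X₂ → Y₂) (hf₂ : IsEmbedding f₂) (hd₂ : DenseRange f₂)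
    (A₁ : Set (Set X₁)) (A₂ : Set (Set X₂))
    (hA₁ : A₁ = {S : Set X₁ | ∃ G : Set Y₁, IsClopen G ∧ S = f₁ ⁻¹' G})
    (hA₂ : A₂ = {S : Set X₂ | ∃ G : Set Y₂, IsClopen G ∧ S = f₂ ⁻¹' G})
    (f : X₁ → X₂) :
    (∃ g : Y₁ → Y₂, Continuous g ∧ ∀ x : X₁, g (f₁ x) = f₂ (f x)) ↔
      (∀ G ∈ A₂, f ⁻¹' G ∈ A₁) := by
  subst hA₁ hA₂
  constructor
  · rintro ⟨g, hg, hgf⟩ _ ⟨G, hG, rfl⟩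
    refine ⟨g ⁻¹' G, hG.preimage hg, ?_⟩
    ext x
    simp [hgf]
  · intro h
    have hh : ∀ G : Set Y₂, IsClopen G →
        ∃ H : Set Y₁, IsClopen H ∧ (f₂ ∘ f) ⁻¹' G = f₁ ⁻¹' H :=
      fun G hG => h _ ⟨G, hG, rfl⟩
    have hcont : Continuous (f₂ ∘ f) := hY₂.continuous_iff.2 fun G hG => by
      obtain ⟨H, hH, hGH⟩ := hh G hG
      exact hGH ▸ hH.isOpen.preimage hf₁.continuous
    have di : IsDenseInducing f₁ := ⟨hf₁.isInducing, hd₁⟩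
    exact ⟨di.extend (f₂ ∘ f),
      di.continuous_extend (exists_tendsto_comap_nhds_of_isClopen hY₂ hd₁ hh),
      fun x => di.extend_eq hcont x⟩
end

section
/- Let X₁ and X₂ be zero-dimensional Hausdorff spaces. Let β : X₁ → Y₁ be a topological embedding with dense image into a compact Hausdorff zero-dimensional space Y₁ such that every clopen subset of X₁ is of the form β⁻¹(G) for some clopen G ⊆ Y₁ (i.e. (Y₁, β) is the Banaschewski compactification of X₁), and let c : X₂ → Y₂ be a topological embedding with dense image into a compact Hausdorff zero-dimensional space Y₂. Then for every continuous function f : X₁ → X₂ there exists a continuous function g : Y₁ → Y₂ such that g ∘ β = c ∘ f. -/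
open Topology TopologicalSpace Set

/-- If every clopen subset of `X` is the trace of a clopen subset of `Y` along a dense inducing map
`i : X → Y`, then every continuous map from `X` to a compact space with a clopen basis converges
along the trace of each neighbourhood filter of `Y`. -/
theorem IsDenseInducing.exists_tendsto_comap_nhds_of_clopen_trace {X Y Z : Type*}
    [TopologicalSpace X] [TopologicalSpace Y] [TopologicalSpace Z] [CompactSpace Z]
    (hZ : IsTopologicalBasis {s : Set Z | IsClopen s}) {i : X → Y} (hi : IsDenseInducing i)
    (htrace : ∀ S : Set X, IsClopen S → ∃ G : Set Y, IsClopen G ∧ S = i ⁻¹' G)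
    {h : X → Z} (hh : Continuous h) (b : Y) :
    ∃ p : Z, Filter.Tendsto h (Filter.comap i (𝓝 b)) (𝓝 p) := by
  have := hi.comap_nhds_neBot b
  obtain ⟨p, hp⟩ := exists_clusterPt_of_compactSpace (Filter.map h (Filter.comap i (𝓝 b)))
  refine ⟨p, hZ.nhds_hasBasis.tendsto_right_iff.2 ?_⟩
  rintro U ⟨hU, hpU⟩
  obtain ⟨G, hG, hUG⟩ := htrace (h ⁻¹' U) (hU.preimage hh)
  have mem_iff (x : X) : h x ∈ U ↔ i x ∈ G := Set.ext_iff.1 hUG x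
  by_cases hb : b ∈ G
  · filter_upwards [Filter.preimage_mem_comap (hG.isOpen.mem_nhds hb)] with x hx
    exact (mem_iff x).2 hx
  · have hUc : Uᶜ ∈ Filter.map h (Filter.comap i (𝓝 b)) := by
      rw [Filter.mem_map]
      filter_upwards [Filter.preimage_mem_comap (hG.compl.isOpen.mem_nhds hb)] with x hx
      exact fun hxU => hx ((mem_iff x).1 hxU)
    obtain ⟨z, hzU, hzUc⟩ := clusterPt_iff_nonempty.1 hp (hU.isOpen.mem_nhds hpU) hUc
    exact absurd hzU hzUc

theorem stmt9 {X₁ X₂ Y₁ Y₂ : Type*}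
    [TopologicalSpace X₁] [T2Space X₁]
    (hX₁ : IsTopologicalBasis {s : Set X₁ | IsClopen s})
    [TopologicalSpace X₂] [T2Space X₂]
    (hX₂ : IsTopologicalBasis {s : Set X₂ | IsClopen s})
    [TopologicalSpace Y₁] [T2Space Y₁] [CompactSpace Y₁]
    (hY₁ : IsTopologicalBasis {s : Set Y₁ | IsClopen s})
    [TopologicalSpace Y₂] [T2Space Y₂] [CompactSpace Y₂]
    (hY₂ : IsTopologicalBasis {s : Set Y₂ | IsClopen s})
    (β : X₁ → Y₁) (hβ : IsEmbedding β) (hβd : DenseRange β)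
    (hBan : ∀ S : Set X₁, IsClopen S → ∃ G : Set Y₁, IsClopen G ∧ S = β ⁻¹' G)
    (c : X₂ → Y₂) (hc : IsEmbedding c) (hcd : DenseRange c)
    (f : X₁ → X₂) (hf : Continuous f) :
    ∃ g : Y₁ → Y₂, Continuous g ∧ ∀ x : X₁, g (β x) = c (f x) := by
  have hi : IsDenseInducing β := ⟨hβ.isInducing, hβd⟩
  have hcf : Continuous (c ∘ f) := hc.continuous.comp hf
  exact ⟨hi.extend (c ∘ f),
    hi.continuous_extend (hi.exists_tendsto_comap_nhds_of_clopen_trace hY₂ hBan hcf),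
    hi.extend_eq hcf⟩
end

section
/- Let f : X → Y be a continuous map between topological spaces. Then f is skeletal (i.e. for every open V ⊆ Y, int(f⁻¹(cl(V))) ⊆ cl(f⁻¹(V))) if and only if for every open subset V of Y whose closure cl_Y(V) is open, one has cl_X(f⁻¹(V)) = f⁻¹(cl_Y(V)). -/
open Topology TopologicalSpace Set

theorem stmt10 {X Y : Type*} [TopologicalSpace X] [TopologicalSpace Y]
    (f : X → Y) (hf : Continuous f) :
    (∀ V : Set Y, IsOpen V → interior (f ⁻¹' closure V) ⊆ closure (f ⁻¹' V)) ↔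
      (∀ V : Set Y, IsOpen V → IsOpen (closure V) →
        closure (f ⁻¹' V) = f ⁻¹' closure V) := by
  constructor
  · intro h V hV hcV
    refine (hf.closure_preimage_subset V).antisymm ?_
    have hint := h V hV
    rwa [(hcV.preimage hf).interior_eq] at hint
  · intro h V hV x hx
    -- `V ∪ (closure V)ᶜ` is open and dense, so its preimage is dense.
    have hdense : closure (V ∪ (closure V)ᶜ) = univ := by
      rw [closure_union, eq_univ_iff_forall]
      intro y
      by_cases hy : y ∈ closure V
      · exact Or.inl hy
      · exact Or.inr (subset_closure hy)
    have hpre := h (V ∪ (closure V)ᶜ) (hV.union isClosed_closure.isOpen_compl)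
      (hdense ▸ isOpen_univ)
    rw [hdense, preimage_univ] at hpre
    have hxW : x ∈ closure (f ⁻¹' (V ∪ (closure V)ᶜ)) := hpre ▸ mem_univ x
    rw [mem_closure_iff] at hxW ⊢
    intro U hU hxU
    obtain ⟨z, ⟨hzU, hzV⟩, hzW⟩ := hxW _ (hU.inter isOpen_interior) ⟨hxU, hx⟩
    exact ⟨z, hzU, hzW.resolve_right fun hz => hz (interior_subset (s := f ⁻¹' closure V) hzV)⟩
end

section
/- Let X₁, X₂, Y₁, Y₂ be topological spaces, and for i = 1, 2 let fᵢ : Xᵢ → Yᵢ be a topological embedding with dense image. Let f : X₁ → X₂ and g : Y₁ → Y₂ be continuous maps with g ∘ f₁ = f₂ ∘ f. Then g is skeletal if and only if f is skeletal. -/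
open Topology TopologicalSpace Set

/-- The closure of the trace of an open set on a dense subspace is the trace of its
closure. -/
theorem closure_preimage_eq_of_isInducing_of_denseRange {X Y : Type*} [TopologicalSpace X]
    [TopologicalSpace Y] {e : X → Y} (he : IsInducing e) (hd : DenseRange e) {W : Set Y}
    (hW : IsOpen W) : closure (e ⁻¹' W) = e ⁻¹' closure W := by
  rw [he.closure_eq_preimage_closure_image, image_preimage_eq_inter_range,
    (closure_mono inter_subset_left).antisymm
      (closure_minimal (Dense.open_subset_closure_inter hd hW) isClosed_closure)]

theorem stmt12 {X₁ X₂ Y₁ Y₂ : Type*}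
    [TopologicalSpace X₁] [TopologicalSpace X₂]
    [TopologicalSpace Y₁] [TopologicalSpace Y₂]
    (f₁ : X₁ → Y₁) (hf₁ : IsEmbedding f₁) (hd₁ : DenseRange f₁)
    (f₂ : X₂ → Y₂) (hf₂ : IsEmbedding f₂) (hd₂ : DenseRange f₂)
    (f : X₁ → X₂) (hf : Continuous f)
    (g : Y₁ → Y₂) (hg : Continuous g)
    (hcomm : ∀ x : X₁, g (f₁ x) = f₂ (f x)) :
    (∀ V : Set Y₂, IsOpen V → interior (g ⁻¹' closure V) ⊆ closure (g ⁻¹' V)) ↔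
      (∀ V : Set X₂, IsOpen V → interior (f ⁻¹' closure V) ⊆ closure (f ⁻¹' V)) := by
  have hpre (A : Set Y₂) : f ⁻¹' (f₂ ⁻¹' A) = f₁ ⁻¹' (g ⁻¹' A) := by
    ext x
    simp [hcomm]
  have hcl {W : Set Y₂} (hW : IsOpen W) :
      f ⁻¹' closure (f₂ ⁻¹' W) = f₁ ⁻¹' (g ⁻¹' closure W) := by
    rw [closure_preimage_eq_of_isInducing_of_denseRange hf₂.isInducing hd₂ hW, hpre]
  have hcl' {W : Set Y₂} (hW : IsOpen W) :
      closure (f ⁻¹' (f₂ ⁻¹' W)) = f₁ ⁻¹' closure (g ⁻¹' W) := by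
    rw [hpre, closure_preimage_eq_of_isInducing_of_denseRange hf₁.isInducing hd₁
      (hW.preimage hg)]
  constructor
  · intro h V hV x hx
    obtain ⟨W, hW, rfl⟩ := hf₂.isInducing.isOpen_iff.1 hV
    rw [hcl hW] at hx
    rw [hcl' hW]
    obtain ⟨U, hUsub, hU, hxU⟩ := mem_interior.1 hx
    obtain ⟨U', hU', rfl⟩ := hf₁.isInducing.isOpen_iff.1 hU
    refine h W hW (mem_interior.2 ⟨U', ?_, hU', hxU⟩)
    refine (Dense.open_subset_closure_inter hd₁ hU').trans
      (closure_minimal ?_ (isClosed_closure.preimage hg))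
    rintro _ ⟨hz, z, rfl⟩
    exact hUsub hz
  · intro h W hW
    refine (Dense.open_subset_closure_inter hd₁ isOpen_interior).trans
      (closure_minimal ?_ isClosed_closure)
    rintro _ ⟨hz, z, rfl⟩
    have hz' : z ∈ closure (f ⁻¹' (f₂ ⁻¹' W)) := by
      refine h _ (hW.preimage hf₂.continuous) ?_
      rw [hcl hW]
      exact preimage_interior_subset_interior_preimage hf₁.continuous hz
    rwa [hcl' hW] at hz'
end

section
/- Let X₁ and X₂ be zero-dimensional Hausdorff spaces, and for i = 1, 2 let fᵢ : Xᵢ → Yᵢ be a topological embedding with dense image into a zero-dimensional locally compact Hausdorff space Yᵢ; set Aᵢ = {fᵢ⁻¹(G) : G clopen in Yᵢ} and Iᵢ = {fᵢ⁻¹(G) : G compact clopen in Yᵢ}. Let f : X₁ → X₂ satisfy (ZEQ1): for every G ∈ A₂, f⁻¹(G) ∈ A₁, and (ZEQ2): for every F ∈ I₁ there exists G ∈ I₂ with f(F) ⊆ G, and let g : Y₁ → Y₂ be a continuous map with g ∘ f₁ = f₂ ∘ f. Then g is an open map if and only if for every F ∈ I₁, the closure cl_{X₂}(f(F)) belongs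 to I₂. -/
open Topology TopologicalSpace Set

/-- A compact clopen set is the closure of its trace on the range of a dense map, so its continuous
image is the closure of the image of that trace. -/
theorem image_eq_closure_image_preimage {X Y Z : Type*} [TopologicalSpace Y] [TopologicalSpace Z]
    [T2Space Z] {i : X → Y} (hi : DenseRange i) {g : Y → Z} (hg : Continuous g) {G : Set Y}
    (hG : IsClopen G) (hGc : IsCompact G) :
    g '' G = closure ((fun x => g (i x)) '' (i ⁻¹' G)) := by
  have himage : (fun x => g (i x)) '' (i ⁻¹' G) = g '' (G ∩ range i) := by
    rw [← image_preimage_eq_inter_range, image_image]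
  rw [himage]
  apply Subset.antisymm
  · calc g '' G ⊆ g '' closure (G ∩ range i) :=
          image_mono (hi.open_subset_closure_inter hG.isOpen)
      _ ⊆ closure (g '' (G ∩ range i)) := image_closure_subset_closure_image hg
  · exact closure_minimal (image_mono inter_subset_left) (hGc.image hg).isClosed

/-- In a locally compact Hausdorff space with a clopen base, a map sending compact clopen sets to
open sets is open. -/
theorem isOpenMap_of_isOpen_image_compact_clopen {Y Z : Type*} [TopologicalSpace Y]
    [LocallyCompactSpace Y] [TopologicalSpace Z] (hY : IsTopologicalBasis {s : Set Y | IsClopen s})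
    {g : Y → Z} (h : ∀ G : Set Y, IsClopen G → IsCompact G → IsOpen (g '' G)) :
    IsOpenMap g := by
  intro U hU
  rw [isOpen_iff_mem_nhds]
  rintro _ ⟨x, hx, rfl⟩
  obtain ⟨K, hK, hKU, hKc⟩ := local_compact_nhds (hU.mem_nhds hx)
  obtain ⟨G, hG, hxG, hGK⟩ := hY.mem_nhds_iff.1 hK
  exact Filter.mem_of_superset
    ((h G hG (hKc.of_isClosed_subset hG.isClosed hGK)).mem_nhds (mem_image_of_mem g hxG))
    (image_mono (hGK.trans hKU))

theorem stmt13 {X₁ X₂ Y₁ Y₂ : Type*}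
    [TopologicalSpace X₁] [T2Space X₁]
    (hX₁ : IsTopologicalBasis {s : Set X₁ | IsClopen s})
    [TopologicalSpace X₂] [T2Space X₂]
    (hX₂ : IsTopologicalBasis {s : Set X₂ | IsClopen s})
    [TopologicalSpace Y₁] [T2Space Y₁] [LocallyCompactSpace Y₁]
    (hY₁ : IsTopologicalBasis {s : Set Y₁ | IsClopen s})
    [TopologicalSpace Y₂] [T2Space Y₂] [LocallyCompactSpace Y₂]
    (hY₂ : IsTopologicalBasis {s : Set Y₂ | IsClopen s})
    (f₁ : X₁ → Y₁) (hf₁ : IsEmbedding f₁) (hd₁ : DenseRange f₁)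
    (f₂ : X₂ → Y₂) (hf₂ : IsEmbedding f₂) (hd₂ : DenseRange f₂)
    (A₁ I₁ : Set (Set X₁)) (A₂ I₂ : Set (Set X₂))
    (hA₁ : A₁ = {S : Set X₁ | ∃ G : Set Y₁, IsClopen G ∧ S = f₁ ⁻¹' G})
    (hI₁ : I₁ = {S : Set X₁ | ∃ G : Set Y₁, IsClopen G ∧ IsCompact G ∧ S = f₁ ⁻¹' G})
    (hA₂ : A₂ = {S : Set X₂ | ∃ G : Set Y₂, IsClopen G ∧ S = f₂ ⁻¹' G})
    (hI₂ : I₂ = {S : Set X₂ | ∃ G : Set Y₂, IsClopen G ∧ IsCompact G ∧ S = f₂ ⁻¹' G})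
    (f : X₁ → X₂)
    (hZEQ1 : ∀ G ∈ A₂, f ⁻¹' G ∈ A₁)
    (hZEQ2 : ∀ F ∈ I₁, ∃ G ∈ I₂, f '' F ⊆ G)
    (g : Y₁ → Y₂) (hg : Continuous g) (hcomm : ∀ x : X₁, g (f₁ x) = f₂ (f x))
    :
    IsOpenMap g ↔ ∀ F ∈ I₁, closure (f '' F) ∈ I₂ := by
  subst hI₁ hI₂
  have himage : ∀ G : Set Y₁, IsClopen G → IsCompact G →
      g '' G = closure (f₂ '' (f '' (f₁ ⁻¹' G))) := fun G hG hGc => by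
    rw [image_eq_closure_image_preimage hd₁ hg hG hGc, image_image]
    simp only [hcomm]
  constructor
  · rintro hopen _ ⟨G, hG, hGc, rfl⟩
    refine ⟨g '' G, ⟨(hGc.image hg).isClosed, hopen G hG.isOpen⟩, hGc.image hg, ?_⟩
    rw [himage G hG hGc, hf₂.closure_eq_preimage_closure_image]
  · intro h
    refine isOpenMap_of_isOpen_image_compact_clopen hY₁ fun G hG hGc => ?_
    obtain ⟨H, hH, hHc, hcl⟩ := h _ ⟨G, hG, hGc, rfl⟩
    have hHimage : H = closure (f₂ '' (f₂ ⁻¹' H)) := by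
      simpa using image_eq_closure_image_preimage hd₂ continuous_id hH hHc
    rw [himage G hG hGc, ← closure_image_closure hf₂.continuous, hcl, ← hHimage]
    exact hH.isOpen
end

section
/- Let X₁ and X₂ be zero-dimensional Hausdorff spaces, and for i = 1, 2 let fᵢ : Xᵢ → Yᵢ be a topological embedding with dense image into a zero-dimensional locally compact Hausdorff space Yᵢ; set Aᵢ = {fᵢ⁻¹(G) : G clopen in Yᵢ} and Iᵢ = {fᵢ⁻¹(G) : G compact clopen in Yᵢ}. Let f : X₁ → X₂ satisfy (ZEQ1): for every G ∈ A₂, f⁻¹(G) ∈ A₁, and (ZEQ2): for every F ∈ I₁ there exists G ∈ I₂ with f(F) ⊆ G, and let g : Y₁ → Y₂ be a continuous map with g ∘ f₁ = f₂ ∘ f. Then g is injective if and only if for all F₁, F₂ ∈ I₁ with F₁ ∩ F₂ = ∅ there exist G₁, G₂ ∈ I₂ with G₁ ∩ G₂ = ∅, f(F₁) ⊆ G₁ and f(F₂) ⊆ G₂. -/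
open Topology TopologicalSpace Set

theorem exists_compact_clopen_between {Y : Type*} [TopologicalSpace Y] [T2Space Y]
    [LocallyCompactSpace Y] (hY : IsTopologicalBasis {s : Set Y | IsClopen s})
    {K U : Set Y} (hK : IsCompact K) (hU : IsOpen U) (hKU : K ⊆ U) :
    ∃ G : Set Y, IsClopen G ∧ IsCompact G ∧ K ⊆ G ∧ G ⊆ U := by
  refine hK.induction_on (p := fun s => ∃ G : Set Y, IsClopen G ∧ IsCompact G ∧ s ⊆ G ∧ G ⊆ U)
    ⟨∅, isClopen_empty, isCompact_empty, Subset.rfl, empty_subset _⟩ ?_ ?_ ?_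
  · rintro s t hst ⟨G, hG, hGc, htG, hGU⟩
    exact ⟨G, hG, hGc, hst.trans htG, hGU⟩
  · rintro s t ⟨G, hG, hGc, hsG, hGU⟩ ⟨H, hH, hHc, htH, hHU⟩
    exact ⟨G ∪ H, hG.union hH, hGc.union hHc, union_subset_union hsG htH, union_subset hGU hHU⟩
  · intro x hx
    obtain ⟨L, hL, hLU, hLc⟩ := local_compact_nhds (hU.mem_nhds (hKU hx))
    obtain ⟨V, hV, hxV, hVL⟩ := hY.mem_nhds_iff.1 hL
    exact ⟨V, mem_nhdsWithin_of_mem_nhds (IsOpen.mem_nhds hV.isOpen hxV), V, hV,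
      hLc.of_isClosed_subset hV.isClosed hVL, Subset.rfl, hVL.trans hLU⟩

theorem disjoint_of_preimage_inter_eq_empty {X Y : Type*} [TopologicalSpace Y] {f : X → Y}
    (hf : DenseRange f) {G H : Set Y} (hG : IsOpen G) (hH : IsOpen H)
    (h : f ⁻¹' G ∩ f ⁻¹' H = ∅) : Disjoint G H := by
  rw [disjoint_iff_inter_eq_empty, ← not_nonempty_iff_eq_empty]
  intro hne
  obtain ⟨x, hx⟩ := hf.exists_mem_open (hG.inter hH) hne
  exact (h ▸ hx : x ∈ (∅ : Set X))

theorem mapsTo_of_image_preimage_subset {X₁ X₂ Y₁ Y₂ : Type*} [TopologicalSpace Y₁]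
    [TopologicalSpace Y₂] {f₁ : X₁ → Y₁} {f₂ : X₂ → Y₂} {f : X₁ → X₂} {g : Y₁ → Y₂}
    (hf₁ : DenseRange f₁) (hg : Continuous g) (hcomm : ∀ x, g (f₁ x) = f₂ (f x))
    {H : Set Y₁} {K : Set Y₂} (hH : IsOpen H) (hK : IsClosed K)
    (h : f '' (f₁ ⁻¹' H) ⊆ f₂ ⁻¹' K) : MapsTo g H K := by
  intro y hy
  by_contra hyK
  obtain ⟨x, hxH, hxK⟩ := hf₁.exists_mem_open (hH.inter (hK.isOpen_compl.preimage hg)) ⟨y, hy, hyK⟩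
  apply hxK
  rw [hcomm]
  exact h (mem_image_of_mem f hxH)

theorem stmt15 {X₁ X₂ Y₁ Y₂ : Type*}
    [TopologicalSpace X₁] [T2Space X₁]
    (hX₁ : IsTopologicalBasis {s : Set X₁ | IsClopen s})
    [TopologicalSpace X₂] [T2Space X₂]
    (hX₂ : IsTopologicalBasis {s : Set X₂ | IsClopen s})
    [TopologicalSpace Y₁] [T2Space Y₁] [LocallyCompactSpace Y₁]
    (hY₁ : IsTopologicalBasis {s : Set Y₁ | IsClopen s})
    [TopologicalSpace Y₂] [T2Space Y₂] [LocallyCompactSpace Y₂]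
    (hY₂ : IsTopologicalBasis {s : Set Y₂ | IsClopen s})
    (f₁ : X₁ → Y₁) (hf₁ : IsEmbedding f₁) (hd₁ : DenseRange f₁)
    (f₂ : X₂ → Y₂) (hf₂ : IsEmbedding f₂) (hd₂ : DenseRange f₂)
    (A₁ I₁ : Set (Set X₁)) (A₂ I₂ : Set (Set X₂))
    (hA₁ : A₁ = {S : Set X₁ | ∃ G : Set Y₁, IsClopen G ∧ S = f₁ ⁻¹' G})
    (hI₁ : I₁ = {S : Set X₁ | ∃ G : Set Y₁, IsClopen G ∧ IsCompact G ∧ S = f₁ ⁻¹' G})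
    (hA₂ : A₂ = {S : Set X₂ | ∃ G : Set Y₂, IsClopen G ∧ S = f₂ ⁻¹' G})
    (hI₂ : I₂ = {S : Set X₂ | ∃ G : Set Y₂, IsClopen G ∧ IsCompact G ∧ S = f₂ ⁻¹' G})
    (f : X₁ → X₂)
    (hZEQ1 : ∀ G ∈ A₂, f ⁻¹' G ∈ A₁)
    (hZEQ2 : ∀ F ∈ I₁, ∃ G ∈ I₂, f '' F ⊆ G)
    (g : Y₁ → Y₂) (hg : Continuous g) (hcomm : ∀ x : X₁, g (f₁ x) = f₂ (f x))
    :
    Function.Injective g ↔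
      (∀ F₁ ∈ I₁, ∀ F₂ ∈ I₁, F₁ ∩ F₂ = ∅ →
        ∃ G₁ ∈ I₂, ∃ G₂ ∈ I₂, G₁ ∩ G₂ = ∅ ∧ f '' F₁ ⊆ G₁ ∧ f '' F₂ ⊆ G₂) := by
  subst hI₁ hI₂
  constructor
  · rintro hinj _ ⟨H₁, hH₁, hc₁, rfl⟩ _ ⟨H₂, hH₂, hc₂, rfl⟩ hdisj
    have hH := disjoint_of_preimage_inter_eq_empty hd₁ hH₁.isOpen hH₂.isOpen hdisj
    obtain ⟨K₁, hK₁, hKc₁, hHK₁, hK₁U⟩ := exists_compact_clopen_between hY₂ (hc₁.image hg)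
      (hc₂.image hg).isClosed.isOpen_compl
      ((disjoint_image_iff hinj).2 hH).subset_compl_right
    obtain ⟨K₂, hK₂, hKc₂, hHK₂, hK₂U⟩ := exists_compact_clopen_between hY₂ (hc₂.image hg)
      hK₁.isClosed.isOpen_compl (subset_compl_comm.1 hK₁U)
    refine ⟨_, ⟨K₁, hK₁, hKc₁, rfl⟩, _, ⟨K₂, hK₂, hKc₂, rfl⟩, ?_, ?_, ?_⟩
    · exact eq_empty_of_forall_notMem fun x hx => hK₂U hx.2 hx.1
    · rintro _ ⟨x, hx, rfl⟩
      exact hHK₁ ⟨f₁ x, hx, hcomm x⟩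
    · rintro _ ⟨x, hx, rfl⟩
      exact hHK₂ ⟨f₁ x, hx, hcomm x⟩
  · intro hsep y z hyz
    by_contra hne
    obtain ⟨H₁, hH₁, hc₁, hyH₁, hH₁U⟩ := exists_compact_clopen_between hY₁
      (isCompact_singleton (x := y)) (isOpen_compl_singleton (x := z))
      (singleton_subset_iff.2 hne)
    obtain ⟨H₂, hH₂, hc₂, hzH₂, hH₂U⟩ := exists_compact_clopen_between hY₁
      (isCompact_singleton (x := z)) hH₁.isClosed.isOpen_compl (subset_compl_comm.1 hH₁U)
    obtain ⟨_, ⟨K₁, hK₁, -, rfl⟩, _, ⟨K₂, hK₂, -, rfl⟩, hK, hs₁, hs₂⟩ :=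
      hsep _ ⟨H₁, hH₁, hc₁, rfl⟩ _ ⟨H₂, hH₂, hc₂, rfl⟩
        (eq_empty_of_forall_notMem fun x hx => hH₂U hx.2 hx.1)
    have hy := mapsTo_of_image_preimage_subset hd₁ hg hcomm hH₁.isOpen hK₁.isClosed hs₁
      (singleton_subset_iff.1 hyH₁)
    have hz := mapsTo_of_image_preimage_subset hd₁ hg hcomm hH₂.isOpen hK₂.isClosed hs₂
      (singleton_subset_iff.1 hzH₂)
    exact disjoint_left.1 (disjoint_of_preimage_inter_eq_empty hd₂ hK₁.isOpen hK₂.isOpen hK) hy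
      (hyz ▸ hz)
end

section
/- Let X₁ and X₂ be zero-dimensional Hausdorff spaces, and for i = 1, 2 let βᵢ : Xᵢ → Yᵢ be a topological embedding with dense image into a compact Hausdorff zero-dimensional space Yᵢ such that every clopen subset of Xᵢ equals βᵢ⁻¹(G) for some clopen G ⊆ Yᵢ (i.e. (Yᵢ, βᵢ) is the Banaschewski compactification of Xᵢ). Let f : X₁ → X₂ be a continuous map and let g : Y₁ → Y₂ be a continuous map with g ∘ β₁ = β₂ ∘ f. Then g is quasi-open (i.e. for every nonempty open U ⊆ Y₁, the interior of g(U) is nonempty) if and only if f is skeletal (i.e. for every open V ⊆ X₂, int(f⁻¹(cl(V))) ⊆ cl(f⁻¹(V))). -/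
open Topology TopologicalSpace Set

/-- A map is skeletal iff the image of every nonempty open set is somewhere dense. -/
theorem skeletal_iff_interior_closure_image_nonempty {X Y : Type*} [TopologicalSpace X]
    [TopologicalSpace Y] (f : X → Y) :
    (∀ V : Set Y, IsOpen V → interior (f ⁻¹' closure V) ⊆ closure (f ⁻¹' V)) ↔
      ∀ U : Set X, IsOpen U → U.Nonempty → (interior (closure (f '' U))).Nonempty := by
  constructor
  · rintro h U hU ⟨x, hx⟩
    by_contra hne
    rw [not_nonempty_iff_eq_empty, interior_eq_empty_iff_dense_compl] at hne
    have hx' : x ∈ closure (f ⁻¹' (closure (f '' U))ᶜ) :=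
      h _ isClosed_closure.isOpen_compl (by simp [hne.closure_eq])
    obtain ⟨y, hyU, hy⟩ := mem_closure_iff.1 hx' U hU hx
    exact hy (subset_closure (mem_image_of_mem f hyU))
  · intro h V hV x hx
    rw [mem_closure_iff]
    intro W hW hxW
    obtain ⟨y, hy⟩ := h _ (hW.inter isOpen_interior) ⟨x, hxW, hx⟩
    have hyV : y ∈ closure V := by
      refine closure_minimal ?_ isClosed_closure (interior_subset hy)
      rintro _ ⟨z, hz, rfl⟩
      exact interior_subset (s := f ⁻¹' closure V) hz.2
    obtain ⟨z, hz, hzV⟩ := mem_closure_iff.1 hyV _ isOpen_interior hy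
    obtain ⟨_, hwV, w, hw, rfl⟩ := mem_closure_iff.1 (interior_subset hz) V hV hzV
    exact ⟨w, hw.1, hwV⟩

/-- A continuous map from a compact Hausdorff space to a Hausdorff space is quasi-open iff the image
of every nonempty open set is somewhere dense. -/
theorem quasiOpen_iff_interior_closure_image_nonempty {X Y : Type*} [TopologicalSpace X]
    [CompactSpace X] [T2Space X] [TopologicalSpace Y] [T2Space Y] {g : X → Y}
    (hg : Continuous g) :
    (∀ U : Set X, IsOpen U → U.Nonempty → (interior (g '' U)).Nonempty) ↔
      ∀ U : Set X, IsOpen U → U.Nonempty → (interior (closure (g '' U))).Nonempty := by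
  constructor
  · exact fun h U hU hne => (h U hU hne).mono (interior_mono subset_closure)
  · rintro h U hU ⟨x, hx⟩
    obtain ⟨K, hK, hKc, hKU⟩ := exists_mem_nhds_isClosed_subset (hU.mem_nhds hx)
    refine (h _ isOpen_interior ⟨x, mem_interior_iff_mem_nhds.2 hK⟩).mono (interior_mono ?_)
    exact (closure_minimal (image_mono interior_subset) (hg.isClosedMap K hKc)).trans
      (image_mono hKU)

/-- Having somewhere dense images of nonempty open sets passes between a map and a continuous
extension of it along dense embeddings. -/
theorem interior_closure_image_nonempty_iff_of_dense_embedding {X₁ X₂ Y₁ Y₂ : Type*}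
    [TopologicalSpace X₁] [TopologicalSpace X₂] [TopologicalSpace Y₁] [TopologicalSpace Y₂]
    {β₁ : X₁ → Y₁} (hβ₁ : IsEmbedding β₁) (hd₁ : DenseRange β₁)
    {β₂ : X₂ → Y₂} (hβ₂ : IsEmbedding β₂) (hd₂ : DenseRange β₂)
    {f : X₁ → X₂} {g : Y₁ → Y₂} (hg : Continuous g) (hcomm : ∀ x, g (β₁ x) = β₂ (f x)) :
    (∀ U : Set Y₁, IsOpen U → U.Nonempty → (interior (closure (g '' U))).Nonempty) ↔
      ∀ U : Set X₁, IsOpen U → U.Nonempty → (interior (closure (f '' U))).Nonempty := by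
  constructor
  · rintro h U hU ⟨x, hx⟩
    obtain ⟨G, hG, rfl⟩ := hβ₁.isOpen_iff.1 hU
    have hsub : closure (g '' G) ⊆ closure (β₂ '' (f '' (β₁ ⁻¹' G))) := by
      refine closure_minimal ?_ isClosed_closure
      calc g '' G ⊆ g '' closure (G ∩ range β₁) :=
            image_mono (hd₁.open_subset_closure_inter hG)
        _ ⊆ closure (g '' (G ∩ range β₁)) := image_closure_subset_closure_image hg
        _ ⊆ closure (β₂ '' (f '' (β₁ ⁻¹' G))) := by
            refine closure_mono ?_
            rintro _ ⟨_, ⟨hz, z, rfl⟩, rfl⟩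
            exact ⟨f z, ⟨z, hz, rfl⟩, (hcomm z).symm⟩
    obtain ⟨z, hz⟩ := hd₂.exists_mem_open isOpen_interior (h G hG ⟨_, hx⟩)
    refine ⟨z, interior_maximal ?_ (isOpen_interior.preimage hβ₂.continuous) hz⟩
    rw [hβ₂.closure_eq_preimage_closure_image]
    exact preimage_mono (interior_subset.trans hsub)
  · intro h U hU hne
    obtain ⟨a, ha⟩ := hd₁.exists_mem_open hU hne
    obtain ⟨x, hx⟩ := h _ (hU.preimage hβ₁.continuous) ⟨a, ha⟩
    obtain ⟨O, hO, hOeq⟩ := hβ₂.isOpen_iff.1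
      (isOpen_interior (s := closure (f '' (β₁ ⁻¹' U))))
    rw [← hOeq] at hx
    refine ⟨β₂ x, interior_maximal ?_ hO hx⟩
    refine (hd₂.open_subset_closure_inter hO).trans (closure_minimal ?_ isClosed_closure)
    rintro _ ⟨hzO, z, rfl⟩
    have hz : z ∈ closure (f '' (β₁ ⁻¹' U)) := interior_subset (hOeq.subset hzO)
    rw [hβ₂.closure_eq_preimage_closure_image] at hz
    refine closure_mono ?_ hz
    rintro _ ⟨_, ⟨w, hw, rfl⟩, rfl⟩
    exact ⟨β₁ w, hw, hcomm w⟩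

theorem stmt18 {X₁ X₂ Y₁ Y₂ : Type*}
    [TopologicalSpace X₁] [T2Space X₁]
    (hX₁ : IsTopologicalBasis {s : Set X₁ | IsClopen s})
    [TopologicalSpace X₂] [T2Space X₂]
    (hX₂ : IsTopologicalBasis {s : Set X₂ | IsClopen s})
    [TopologicalSpace Y₁] [T2Space Y₁] [CompactSpace Y₁]
    (hY₁ : IsTopologicalBasis {s : Set Y₁ | IsClopen s})
    [TopologicalSpace Y₂] [T2Space Y₂] [CompactSpace Y₂]
    (hY₂ : IsTopologicalBasis {s : Set Y₂ | IsClopen s})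
    (β₁ : X₁ → Y₁) (hβ₁ : IsEmbedding β₁) (hd₁ : DenseRange β₁)
    (hBan₁ : ∀ S : Set X₁, IsClopen S → ∃ G : Set Y₁, IsClopen G ∧ S = β₁ ⁻¹' G)
    (β₂ : X₂ → Y₂) (hβ₂ : IsEmbedding β₂) (hd₂ : DenseRange β₂)
    (hBan₂ : ∀ S : Set X₂, IsClopen S → ∃ G : Set Y₂, IsClopen G ∧ S = β₂ ⁻¹' G)
    (f : X₁ → X₂) (hf : Continuous f)
    (g : Y₁ → Y₂) (hg : Continuous g)
    (hcomm : ∀ x : X₁, g (β₁ x) = β₂ (f x)) :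
    (∀ U : Set Y₁, IsOpen U → U.Nonempty → (interior (g '' U)).Nonempty) ↔
      (∀ V : Set X₂, IsOpen V → interior (f ⁻¹' closure V) ⊆ closure (f ⁻¹' V)) := by
  rw [quasiOpen_iff_interior_closure_image_nonempty hg,
    skeletal_iff_interior_closure_image_nonempty]
  exact interior_closure_image_nonempty_iff_of_dense_embedding hβ₁ hd₁ hβ₂ hd₂ hg hcomm
end

section
/- Let X₁ and X₂ be zero-dimensional Hausdorff spaces, and for i = 1, 2 let βᵢ : Xᵢ → Yᵢ be a topological embedding with dense image into a compact Hausdorff zero-dimensional space Yᵢ such that every clopen subset of Xᵢ equals βᵢ⁻¹(G) for some clopen G ⊆ Yᵢ (i.e. (Yᵢ, βᵢ) is the Banaschewski compactification of Xᵢ). Let f : X₁ → X₂ be a continuous map and let g : Y₁ → Y₂ be a continuous map with g ∘ β₁ = β₂ ∘ f. Then g is an open map if and only if for every clopen subset F of X₁, the closure cl_{X₂}(f(F)) is a clopen subset of X₂. -/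
open Topology TopologicalSpace Set

/-- A clopen set is the closure of the image of its preimage under a map with dense range. -/
theorem DenseRange.closure_image_preimage_of_isClopen {X Y : Type*} [TopologicalSpace Y]
    {β : X → Y} (hd : DenseRange β) {G : Set Y} (hG : IsClopen G) :
    closure (β '' (β ⁻¹' G)) = G := by
  rw [image_preimage_eq_inter_range]
  refine subset_antisymm (closure_minimal inter_subset_left hG.isClosed) ?_
  exact Dense.open_subset_closure_inter hd hG.isOpen

theorem stmt19 {X₁ X₂ Y₁ Y₂ : Type*}
    [TopologicalSpace X₁] [T2Space X₁]
    (hX₁ : IsTopologicalBasis {s : Set X₁ | IsClopen s})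
    [TopologicalSpace X₂] [T2Space X₂]
    (hX₂ : IsTopologicalBasis {s : Set X₂ | IsClopen s})
    [TopologicalSpace Y₁] [T2Space Y₁] [CompactSpace Y₁]
    (hY₁ : IsTopologicalBasis {s : Set Y₁ | IsClopen s})
    [TopologicalSpace Y₂] [T2Space Y₂] [CompactSpace Y₂]
    (hY₂ : IsTopologicalBasis {s : Set Y₂ | IsClopen s})
    (β₁ : X₁ → Y₁) (hβ₁ : IsEmbedding β₁) (hd₁ : DenseRange β₁)
    (hBan₁ : ∀ S : Set X₁, IsClopen S → ∃ G : Set Y₁, IsClopen G ∧ S = β₁ ⁻¹' G)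
    (β₂ : X₂ → Y₂) (hβ₂ : IsEmbedding β₂) (hd₂ : DenseRange β₂)
    (hBan₂ : ∀ S : Set X₂, IsClopen S → ∃ G : Set Y₂, IsClopen G ∧ S = β₂ ⁻¹' G)
    (f : X₁ → X₂) (hf : Continuous f)
    (g : Y₁ → Y₂) (hg : Continuous g)
    (hcomm : ∀ x : X₁, g (β₁ x) = β₂ (f x)) :
    IsOpenMap g ↔ ∀ F : Set X₁, IsClopen F → IsClopen (closure (f '' F)) := by
  have image_eq (G : Set Y₁) (hG : IsClopen G) :
      g '' G = closure (β₂ '' (f '' (β₁ ⁻¹' G))) := by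
    have himage : g '' (β₁ '' (β₁ ⁻¹' G)) = β₂ '' (f '' (β₁ ⁻¹' G)) := by
      simp only [image_image, hcomm]
    rw [← himage, hg.isClosedMap.closure_image_eq_of_continuous hg,
      hd₁.closure_image_preimage_of_isClopen hG]
  constructor
  · intro hopen F hF
    obtain ⟨G, hG, rfl⟩ := hBan₁ F hF
    rw [hβ₂.closure_eq_preimage_closure_image, ← image_eq G hG]
    exact IsClopen.preimage ⟨hg.isClosedMap G hG.isClosed, hopen G hG.isOpen⟩ hβ₂.continuous
  · intro h
    refine hY₁.isOpenMap_iff.2 fun G hG => ?_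
    obtain ⟨H, hH, hHeq⟩ := hBan₂ _ (h _ (IsClopen.preimage hG hβ₁.continuous))
    rw [image_eq G hG, ← closure_image_closure hβ₂.continuous, hHeq,
      hd₂.closure_image_preimage_of_isClopen hH]
    exact hH.isOpen
end
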